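/- If A ⊆ ℤ satisfies δ := 2·d̄(A) − d̄(A+A) > 0, then there exist a positive integer k and a Følner sequence Ψ = (Ψ_n)_{n∈ℕ} in ℤ consisting of finite subsets of the positive integers such that: (i) liminf_{n→∞} |Ψ_n|/(max Ψ_n) ≥ kδ; (ii) the densities d_Ψ(A) and d_Ψ(A+A) exist and 2·d_Ψ(A) − d_Ψ(A+A) ≥ δ; (iii) the densities d_Ψ(A+A) and d_Ψ(A+A+kℤ) both exist and are equal. -/

import Mathlib

open scoped Pointwise
open Filter

namespace SumsetMeans

/-- The density of `C` in the finite set `F n`, i.e. `|C ∩ F n| / |F n|`. -/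
noncomputable def dens (F : ℕ → Finset ℤ) (C : Set ℤ) (n : ℕ) : ℝ :=
  ((C ∩ (F n : Set ℤ)).ncard : ℝ) / ((F n).card : ℝ)

/-- A Følner sequence in `ℤ`: nonempty finite sets that are asymptotically invariant
under every translation. -/
def IsFolnerSeq (F : ℕ → Finset ℤ) : Prop :=
  (∀ n, (F n).Nonempty) ∧
  ∀ t : ℤ, Tendsto (fun n =>
      ((symmDiff ((F n : Set ℤ)) ((F n : Set ℤ) + ({t} : Set ℤ))).ncard : ℝ) / ((F n).card : ℝ))
    atTop (nhds 0)

/-- Upper asymptotic density of a subset of `ℤ`: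
`limsup (1/n) |A ∩ {1, …, n}|`. -/
noncomputable def upperDens (A : Set ℤ) : ℝ :=
  limsup (fun n : ℕ => ((A ∩ Set.Icc 1 (n : ℤ)).ncard : ℝ) / (n : ℝ)) atTop

section Kneser

variable {Z : Type*} [AddCommGroup Z] [Fintype Z]

open Classical in
lemma card_mul_card_le_card_inter_mul {H₁ H₂ : AddSubgroup Z} {U V D : Finset Z} {x : Z}
    (hU : ∀ u ∈ U, u ∈ H₁) (hV : ∀ v ∈ V, v ∈ H₂)
    (hD : ∀ u ∈ U, ∀ v ∈ V, x + u + v ∈ D) :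
    U.card * V.card ≤ Nat.card (H₁ ⊓ H₂ : AddSubgroup Z) * D.card := by
  rw [← Finset.card_product]
  refine Finset.card_le_mul_card_image_of_maps_to (f := fun q : Z × Z => x + q.1 + q.2)
    (fun q hq => ?_) _ (fun d _ => ?_)
  · rw [Finset.mem_product] at hq
    exact hD _ hq.1 _ hq.2
  · rcases Finset.eq_empty_or_nonempty ((U ×ˢ V).filter fun q : Z × Z => x + q.1 + q.2 = d)
      with he | ⟨⟨u₀, v₀⟩, h₀⟩
    · rw [he]; simp
    · simp only [Finset.mem_filter, Finset.mem_product] at h₀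
      obtain ⟨⟨hu₀, hv₀⟩, h₀⟩ := h₀
      have hcard : Nat.card (H₁ ⊓ H₂ : AddSubgroup Z)
          = (Finset.univ.filter (· ∈ H₁ ⊓ H₂) : Finset Z).card := by
        rw [Nat.card_eq_fintype_card, Fintype.card_subtype]
      rw [hcard]
      refine Finset.card_le_card_of_injOn (fun q => q.1 - u₀) ?_ ?_
      · rintro ⟨u, v⟩ hq
        simp only [Finset.coe_filter, Finset.mem_product, Set.mem_ofPred_eq] at hq
        obtain ⟨⟨hu, hv⟩, hq⟩ := hq
        simp only [Finset.coe_filter, Finset.mem_univ, true_and, Set.mem_ofPred_eq,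
          AddSubgroup.mem_inf]
        refine ⟨sub_mem (hU _ hu) (hU _ hu₀), ?_⟩
        have : u - u₀ = v₀ - v := by
          have h1 : u + v = u₀ + v₀ := by
            have := hq.trans h₀.symm
            rwa [add_assoc, add_assoc, add_right_inj] at this
          rw [sub_eq_sub_iff_add_eq_add, h1, add_comm]
        rw [this]
        exact sub_mem (hV _ hv₀) (hV _ hv)
      · rintro ⟨u, v⟩ hq ⟨u', v'⟩ hq' h
        simp only [Finset.coe_filter, Finset.mem_product, Set.mem_ofPred_eq] at hq hq'
        have h1 : u = u' := by simpa using h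
        subst h1
        have := hq.2.trans hq'.2.symm
        simp only [add_right_inj] at this
        rw [this]

/-- `C` is a union of cosets of a subgroup `H` with `t ≤ |C| + |H|`. -/
def HasPeriodBound (t : ℕ) (C : Finset Z) : Prop :=
  ∃ H : AddSubgroup Z, (∀ x ∈ C, ∀ h ∈ H, x + h ∈ C) ∧ t ≤ C.card + Nat.card H

open Classical in
lemma card_sdiff_bounds {H₁ H₂ : AddSubgroup Z} {C₁ C₂ : Finset Z} {x : Z}
    (h₁ : ∀ x ∈ C₁, ∀ h ∈ H₁, x + h ∈ C₁) (h₂ : ∀ x ∈ C₂, ∀ h ∈ H₂, x + h ∈ C₂)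
    (hx₁ : x ∉ C₁) (hx₂ : x ∈ C₂) :
    ∃ a b : ℕ, Nat.card (H₁ ⊓ H₂ : AddSubgroup Z) ≤ a ∧ Nat.card (H₁ ⊓ H₂ : AddSubgroup Z) ≤ b ∧
      a ≤ Nat.card H₁ ∧ b ≤ Nat.card H₂ ∧
      (a < Nat.card H₁ → a + Nat.card (H₁ ⊓ H₂ : AddSubgroup Z) ≤ Nat.card H₁) ∧
      (b < Nat.card H₂ → b + Nat.card (H₁ ⊓ H₂ : AddSubgroup Z) ≤ Nat.card H₂) ∧
      a * b ≤ Nat.card (H₁ ⊓ H₂ : AddSubgroup Z) * (C₂ \ C₁).card ∧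
      (Nat.card H₁ - a) * (Nat.card H₂ - b) ≤
        Nat.card (H₁ ⊓ H₂ : AddSubgroup Z) * (C₁ \ C₂).card := by
  have hcard : ∀ H : AddSubgroup Z, Nat.card H = (Finset.univ.filter (· ∈ H) : Finset Z).card := by
    intro H
    rw [Nat.card_eq_fintype_card, Fintype.card_subtype]
  have n₁ : ∀ y, y ∉ C₁ → ∀ h ∈ H₁, y + h ∉ C₁ := fun y hy h hh hc =>
    hy (by simpa using h₁ _ hc _ (neg_mem hh))
  have n₂ : ∀ y, y ∉ C₂ → ∀ h ∈ H₂, y + h ∉ C₂ := fun y hy h hh hc =>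
    hy (by simpa using h₂ _ hc _ (neg_mem hh))
  set U : Finset Z := Finset.univ.filter (fun h => h ∈ H₁ ∧ x + h ∈ C₂) with hU
  set U' : Finset Z := Finset.univ.filter (fun h => h ∈ H₁ ∧ x + h ∉ C₂) with hU'
  set V : Finset Z := Finset.univ.filter (fun h => h ∈ H₂ ∧ x + h ∉ C₁) with hV
  set V' : Finset Z := Finset.univ.filter (fun h => h ∈ H₂ ∧ x + h ∈ C₁) with hV'
  have hUU : U.card + U'.card = Nat.card H₁ := by
    rw [hcard, ← Finset.card_filter_add_card_filter_not (s := Finset.univ.filter (· ∈ H₁))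
      (fun h => x + h ∈ C₂), Finset.filter_filter, Finset.filter_filter]
  have hVV : V.card + V'.card = Nat.card H₂ := by
    rw [hcard, ← Finset.card_filter_add_card_filter_not (s := Finset.univ.filter (· ∈ H₂))
      (fun h => x + h ∉ C₁), Finset.filter_filter, Finset.filter_filter]
    simp only [not_not, hV, hV']
  have hI : ∀ (S : Finset Z) (s : Z), (∀ h ∈ H₁ ⊓ H₂, s + h ∈ S) →
      Nat.card (H₁ ⊓ H₂ : AddSubgroup Z) ≤ S.card := by
    intro S s hS
    rw [hcard]
    refine Finset.card_le_card_of_injOn (fun h => s + h) (fun h hh => ?_)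
      (fun _ _ _ _ h => by simpa using h)
    exact hS h (by simpa using hh)
  have hUx := hI U 0 (fun h hh => by
    rw [AddSubgroup.mem_inf] at hh
    simpa [hU] using ⟨hh.1, h₂ _ hx₂ _ hh.2⟩)
  have hVx := hI V 0 (fun h hh => by
    rw [AddSubgroup.mem_inf] at hh
    simpa [hV] using ⟨hh.2, n₁ _ hx₁ _ hh.1⟩)
  refine ⟨U.card, V.card, hUx, hVx, by omega, by omega, fun hlt => ?_, fun hlt => ?_, ?_, ?_⟩
  · obtain ⟨s, hs⟩ : U'.Nonempty := Finset.card_pos.1 (by omega)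
    simp only [hU', Finset.mem_filter, Finset.mem_univ, true_and] at hs
    have := hI U' s (fun h hh => by
      rw [AddSubgroup.mem_inf] at hh
      simp only [hU', Finset.mem_filter, Finset.mem_univ, true_and, ← add_assoc]
      exact ⟨add_mem hs.1 hh.1, n₂ _ hs.2 _ hh.2⟩)
    omega
  · obtain ⟨s, hs⟩ : V'.Nonempty := Finset.card_pos.1 (by omega)
    simp only [hV', Finset.mem_filter, Finset.mem_univ, true_and] at hs
    have := hI V' s (fun h hh => by
      rw [AddSubgroup.mem_inf] at hh
      simp only [hV', Finset.mem_filter, Finset.mem_univ, true_and, ← add_assoc]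
      exact ⟨add_mem hs.1 hh.2, h₁ _ hs.2 _ hh.1⟩)
    omega
  · refine card_mul_card_le_card_inter_mul (x := x) (fun u hu => ?_) (fun v hv => ?_)
      (fun u hu v hv => ?_)
    · exact (Finset.mem_filter.1 hu).2.1
    · exact (Finset.mem_filter.1 hv).2.1
    · have hu := (Finset.mem_filter.1 hu).2
      have hv := (Finset.mem_filter.1 hv).2
      rw [Finset.mem_sdiff]
      refine ⟨h₂ _ hu.2 _ hv.1, ?_⟩
      rw [add_right_comm]
      exact n₁ _ hv.2 _ hu.1
  · have e1 : Nat.card H₁ - U.card = U'.card := by omega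
    have e2 : Nat.card H₂ - V.card = V'.card := by omega
    rw [e1, e2]
    refine card_mul_card_le_card_inter_mul (x := x) (fun u hu => ?_) (fun v hv => ?_)
      (fun u hu v hv => ?_)
    · exact (Finset.mem_filter.1 hu).2.1
    · exact (Finset.mem_filter.1 hv).2.1
    · have hu := (Finset.mem_filter.1 hu).2
      have hv := (Finset.mem_filter.1 hv).2
      rw [Finset.mem_sdiff]
      refine ⟨?_, n₂ _ hu.2 _ hv.1⟩
      rw [add_right_comm]
      exact h₁ _ hv.2 _ hu.1

/-- The numerical part of Kneser's union lemma, for an `n₁ × n₂` grid. -/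
lemma grid_bound {h a b n₁ n₂ d₁ d₂ : ℕ} (hpos : 0 < h) (ha : h ≤ a) (hb : h ≤ b)
    (ha' : a ≤ n₁) (hb' : b ≤ n₂) (haa : a < n₁ → a + h ≤ n₁) (hbb : b < n₂ → b + h ≤ n₂)
    (hd₂ : a * b ≤ h * d₂) (hd₁ : (n₁ - a) * (n₂ - b) ≤ h * d₁) :
    n₁ ≤ d₂ + h ∨ n₂ ≤ d₁ + h ∨ n₂ ≤ d₂ := by
  rcases ha'.lt_or_eq with ha1 | rfl
  · rcases hb'.lt_or_eq with hb1 | rfl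
    · obtain ⟨q, rfl⟩ := Nat.exists_eq_add_of_le (haa ha1)
      obtain ⟨u, rfl⟩ := Nat.exists_eq_add_of_le (hbb hb1)
      obtain ⟨a, rfl⟩ := Nat.exists_eq_add_of_le ha
      obtain ⟨b, rfl⟩ := Nat.exists_eq_add_of_le hb
      have e1 : h + a + h + q - (h + a) = h + q := by omega
      have e2 : h + b + h + u - (h + b) = h + u := by omega
      rw [e1, e2] at hd₁
      by_contra! hcon
      obtain ⟨c1, c2, -⟩ := hcon
      have c1' : d₂ + 1 ≤ h + a + q := by omega
      have c2' : d₁ + 1 ≤ h + b + u := by omega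
      have k1 := Nat.mul_le_mul_left h c1'
      have k2 := Nat.mul_le_mul_left h c2'
      have : h * b < h * q := by nlinarith [Nat.zero_le (a * b)]
      have : h * q < h * b := by nlinarith [Nat.zero_le (u * q)]
      omega
    · right; right
      have : h * b ≤ h * d₂ := le_trans (Nat.mul_le_mul_right b ha) hd₂
      exact Nat.le_of_mul_le_mul_left this hpos
  · left
    have : h * a ≤ h * d₂ := by
      refine le_trans ?_ hd₂
      rw [mul_comm h a]
      exact Nat.mul_le_mul_left a hb
    have := Nat.le_of_mul_le_mul_left this hpos
    omega

open Classical in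
/-- **Kneser's union lemma**. -/
lemma HasPeriodBound.union {t : ℕ} {C₁ C₂ : Finset Z} (h₁ : HasPeriodBound t C₁)
    (h₂ : HasPeriodBound t C₂) : HasPeriodBound t (C₁ ∪ C₂) := by
  by_cases hs₁ : C₂ ⊆ C₁
  · rwa [Finset.union_eq_left.2 hs₁]
  by_cases hs₂ : C₁ ⊆ C₂
  · rwa [Finset.union_eq_right.2 hs₂]
  obtain ⟨H₁, p₁, c₁⟩ := h₁
  obtain ⟨H₂, p₂, c₂⟩ := h₂
  obtain ⟨x, hx₂, hx₁⟩ := Finset.not_subset.1 hs₁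
  obtain ⟨y, hy₁, hy₂⟩ := Finset.not_subset.1 hs₂
  refine ⟨H₁ ⊓ H₂, fun z hz h hh => ?_, ?_⟩
  · rw [AddSubgroup.mem_inf] at hh
    rw [Finset.mem_union] at hz ⊢
    exact hz.imp (fun hz => p₁ _ hz _ hh.1) (fun hz => p₂ _ hz _ hh.2)
  obtain ⟨a, b, i1, i2, i3, i4, i5, i6, i7, i8⟩ := card_sdiff_bounds p₁ p₂ hx₁ hx₂
  obtain ⟨a', b', j1, j2, j3, j4, j5, j6, j7, j8⟩ := card_sdiff_bounds p₂ p₁ hy₂ hy₁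
  rw [inf_comm] at j1 j2 j5 j6 j7 j8
  have hpos : 0 < Nat.card (H₁ ⊓ H₂ : AddSubgroup Z) := Nat.card_pos
  have e1 : (C₁ ∪ C₂).card = C₁.card + (C₂ \ C₁).card := by
    rw [← Finset.card_union_of_disjoint Finset.disjoint_sdiff, Finset.union_sdiff_self_eq_union]
  have e2 : (C₁ ∪ C₂).card = C₂.card + (C₁ \ C₂).card := by
    rw [← Finset.card_union_of_disjoint Finset.disjoint_sdiff, Finset.union_sdiff_self_eq_union,
      Finset.union_comm]
  have g1 := grid_bound hpos i1 i2 i3 i4 i5 i6 i7 i8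
  have g2 := grid_bound hpos j1 j2 j3 j4 j5 j6 j7 j8
  omega

open Classical in
lemma exists_hasPeriodBound_subset {A B : Finset Z} {a b : Z} (ha : a ∈ A) (hb : b ∈ B) :
    ∃ C : Finset Z, C ⊆ A + B ∧ a + b ∈ C ∧ HasPeriodBound (A.card + B.card) C := by
  induction hn : B.card using Nat.strong_induction_on generalizing A B with
  | _ n ih =>
    by_cases hst : ∀ e ∈ A, ∀ y ∈ B, y + (e - b) ∈ A
    · refine ⟨A.image (· + b), ?_, Finset.mem_image_of_mem _ ha,
        AddAction.stabilizer Z A, ?_, ?_⟩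
      · intro z hz
        obtain ⟨x, hx, rfl⟩ := Finset.mem_image.1 hz
        exact Finset.add_mem_add hx hb
      · intro z hz h hh
        obtain ⟨x, hx, rfl⟩ := Finset.mem_image.1 hz
        refine Finset.mem_image.2 ⟨x + h, ?_, add_right_comm _ _ _⟩
        have hh : h +ᵥ A = A := hh
        rw [← hh, add_comm]
        exact Finset.vadd_mem_vadd_finset hx
      · rw [Finset.card_image_of_injective _ (add_left_injective b), ← hn]
        refine Nat.add_le_add_left ?_ _
        rw [Nat.card_eq_fintype_card, Fintype.card_subtype]
        refine Finset.card_le_card_of_injOn (fun y => y - b) (fun y hy => ?_)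
          (fun _ _ _ _ h => by simpa using h)
        simp only [Finset.coe_filter, Finset.mem_univ, true_and, Set.mem_ofPred_eq,
          AddAction.mem_stabilizer_iff]
        refine Finset.eq_of_subset_of_card_le (fun z hz => ?_) (by simp)
        obtain ⟨x, hx, rfl⟩ := Finset.mem_vadd_finset.1 hz
        have := hst x hx y hy
        rw [vadd_eq_add]
        convert this using 1
        abel
    · push Not at hst
      obtain ⟨e, he, y, hy, hye⟩ := hst
      set A' := A ∪ B.image (· + (e - b)) with hA'
      set B' := B.filter (fun y => y + (e - b) ∈ A) with hB'
      have hlt : B'.card < n := by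
        rw [← hn]
        exact Finset.card_lt_card (Finset.filter_ssubset.2 ⟨y, hy, hye⟩)
      obtain ⟨C, hC, hab, hP⟩ := ih _ hlt (A := A') (B := B')
        (Finset.mem_union_left _ ha) (Finset.mem_filter.2 ⟨hb, by simpa using he⟩) rfl
      have hsum : A'.card + B'.card = A.card + n := by
        have h1 : (A ∩ B.image (· + (e - b))).card = B'.card := by
          rw [← Finset.card_image_of_injective B' (add_left_injective (e - b))]
          congr 1
          ext z
          simp only [hB', Finset.mem_inter, Finset.mem_image, Finset.mem_filter]
          constructor
          · rintro ⟨hz, w, hw, rfl⟩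
            exact ⟨w, ⟨hw, hz⟩, rfl⟩
          · rintro ⟨w, ⟨hw, hz⟩, rfl⟩
            exact ⟨hz, w, hw, rfl⟩
        rw [← h1, hA', Finset.card_union_add_card_inter,
          Finset.card_image_of_injective _ (add_left_injective (e - b)), hn]
      refine ⟨C, hC.trans ?_, hab, hsum ▸ hP⟩
      intro z hz
      obtain ⟨u, hu, v, hv, rfl⟩ := Finset.mem_add.1 hz
      rw [hB', Finset.mem_filter] at hv
      rcases Finset.mem_union.1 hu with hu | hu
      · exact Finset.add_mem_add hu hv.1
      · obtain ⟨w, hw, rfl⟩ := Finset.mem_image.1 hu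
        have : w + (e - b) + v = (v + (e - b)) + w := by abel
        rw [this]
        exact Finset.add_mem_add hv.2 hw

open Classical in
/-- **Kneser's theorem** in a finite abelian group. -/
theorem exists_period_card_add_le (A B : Finset Z) (hA : A.Nonempty) (hB : B.Nonempty) :
    ∃ H : AddSubgroup Z, (∀ x ∈ A + B, ∀ h ∈ H, x + h ∈ A + B) ∧
      A.card + B.card ≤ (A + B).card + Nat.card H := by
  have key : ∀ c ∈ A + B, ∃ C : Finset Z, C ⊆ A + B ∧ c ∈ C ∧
      HasPeriodBound (A.card + B.card) C := by
    intro c hc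
    obtain ⟨a, ha, b, hb, rfl⟩ := Finset.mem_add.1 hc
    exact exists_hasPeriodBound_subset ha hb
  choose! F hFs hFm hFP using key
  obtain ⟨c₀, hc₀⟩ := hA.add hB
  have main : ∀ T : Finset Z, T ⊆ A + B →
      HasPeriodBound (A.card + B.card) (F c₀ ∪ T.biUnion F) := by
    intro T
    induction T using Finset.induction_on with
    | empty => intro _; simpa using hFP _ hc₀
    | insert c T _ ih =>
      intro hT
      rw [Finset.insert_subset_iff] at hT
      rw [Finset.biUnion_insert, Finset.union_left_comm]
      exact (hFP c hT.1).union (ih hT.2)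
  have hfin := main _ subset_rfl
  have : F c₀ ∪ (A + B).biUnion F = A + B := by
    refine Finset.Subset.antisymm (Finset.union_subset (hFs _ hc₀)
      (Finset.biUnion_subset.2 hFs)) (fun c hc => Finset.mem_union_right _ ?_)
    exact Finset.mem_biUnion.2 ⟨c, hc, hFm c hc⟩
  rw [this] at hfin
  exact hfin

end Kneser

section Means

open BoundedContinuousFunction

/-- The indicator function of `S`, as a bounded function on `ℤ`. -/
noncomputable def ind (S : Set ℤ) : ℤ →ᵇ ℝ :=
  BoundedContinuousFunction.ofNormedAddCommGroupDiscrete (S.indicator 1) 1 (fun x => by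
    by_cases h : x ∈ S <;> simp [h])

lemma ind_of_mem {S : Set ℤ} {x : ℤ} (h : x ∈ S) : ind S x = 1 := by simp [ind, h]

lemma ind_of_notMem {S : Set ℤ} {x : ℤ} (h : x ∉ S) : ind S x = 0 := by simp [ind, h]

lemma ind_nonneg (S : Set ℤ) : 0 ≤ ind S := fun x => by
  by_cases h : x ∈ S <;> simp [ind_of_mem, ind_of_notMem, h]

lemma ind_univ : ind Set.univ = 1 := by ext x; simp [ind_of_mem]

lemma ind_mul_ind (S T : Set ℤ) : ind S * ind T = ind (S ∩ T) := by
  ext x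
  by_cases h : x ∈ S <;> by_cases h' : x ∈ T <;> simp [ind_of_mem, ind_of_notMem, h, h']

/-- Translation of bounded functions. -/
noncomputable def shift (n : ℤ) (f : ℤ →ᵇ ℝ) : ℤ →ᵇ ℝ :=
  f.compContinuous ⟨(· + n), continuous_of_discreteTopology⟩

@[simp] lemma shift_apply (n : ℤ) (f : ℤ →ᵇ ℝ) (x : ℤ) : shift n f x = f (x + n) := rfl

/-- The translate `S + n`. -/
def tr (n : ℤ) (S : Set ℤ) : Set ℤ := {x | x - n ∈ S}

@[simp] lemma mem_tr {n : ℤ} {S : Set ℤ} {x : ℤ} : x ∈ tr n S ↔ x - n ∈ S := Iff.rfl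

lemma ind_tr (n : ℤ) (S : Set ℤ) : ind (tr n S) = shift (-n) (ind S) := by
  ext x
  by_cases h : x - n ∈ S
  · rw [ind_of_mem (mem_tr.2 h), shift_apply, ← sub_eq_add_neg, ind_of_mem h]
  · rw [ind_of_notMem (mt mem_tr.1 h), shift_apply, ← sub_eq_add_neg, ind_of_notMem h]

/-- The set of invariant means on `ℤ`. -/
def invMeans : Set (WeakDual ℝ (ℤ →ᵇ ℝ)) :=
  {L | (∀ f, 0 ≤ f → 0 ≤ L f) ∧ L 1 = 1 ∧ ∀ n f, L (shift n f) = L f}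

lemma abs_le_of_nonneg {L : WeakDual ℝ (ℤ →ᵇ ℝ)} (h0 : ∀ f, 0 ≤ f → 0 ≤ L f) (f : ℤ →ᵇ ℝ) :
    |L f| ≤ ‖f‖ * L 1 := by
  have h1 := h0 (‖f‖ • 1 - f) (fun x => by
    simpa using (le_abs_self _).trans (f.norm_coe_le_norm x))
  have h2 := h0 (‖f‖ • 1 + f) (fun x => by
    have := (neg_abs_le (f x)).trans' (neg_le_neg (f.norm_coe_le_norm x))
    simp; linarith)
  rw [map_sub, map_smul, smul_eq_mul] at h1
  rw [map_add, map_smul, smul_eq_mul] at h2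
  rw [abs_le]
  constructor <;> linarith

lemma isCompact_invMeans : IsCompact invMeans := by
  have hsub : invMeans ⊆ WeakDual.toStrongDual ⁻¹' Metric.closedBall 0 1 := by
    rintro L ⟨h0, h1, -⟩
    rw [Set.mem_preimage]
    have hn : ‖WeakDual.toStrongDual L‖ ≤ 1 :=
      ContinuousLinearMap.opNorm_le_bound _ zero_le_one fun f => by
        simpa [h1] using abs_le_of_nonneg h0 f
    exact Metric.mem_closedBall.2 ((dist_zero_right (WeakDual.toStrongDual L)).trans_le hn)
  refine (WeakDual.isCompact_closedBall 0 1).of_isClosed_subset ?_ hsub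
  have hev := fun f : ℤ →ᵇ ℝ => WeakDual.eval_continuous (𝕜 := ℝ) f
  have : invMeans = (⋂ f : ℤ →ᵇ ℝ, ⋂ (_ : 0 ≤ f), {L : WeakDual ℝ (ℤ →ᵇ ℝ) | 0 ≤ L f}) ∩
      ({L | L 1 = 1} ∩ ⋂ n : ℤ, ⋂ f : ℤ →ᵇ ℝ, {L | L (shift n f) = L f}) := by
    ext L; simp [invMeans]
  rw [this]
  exact (isClosed_iInter fun f => isClosed_iInter fun _ =>
    isClosed_le continuous_const (hev f)).inter ((isClosed_eq (hev 1) continuous_const).inter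
    (isClosed_iInter fun n => isClosed_iInter fun f => isClosed_eq (hev _) (hev f)))

lemma convex_invMeans : Convex ℝ invMeans := by
  rintro L ⟨h0, h1, h2⟩ L' ⟨h0', h1', h2'⟩ a b ha hb hab
  have happ : ∀ f, (a • L + b • L') f = a * L f + b * L' f := fun f => rfl
  refine ⟨fun f hf => ?_, ?_, fun n f => ?_⟩
  · rw [happ]
    exact add_nonneg (mul_nonneg ha (h0 f hf)) (mul_nonneg hb (h0' f hf))
  · rw [happ, h1, h1']; linarith
  · rw [happ, happ, h2, h2']

/-- The ergodic invariant means. -/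
def ergMeans : Set (WeakDual ℝ (ℤ →ᵇ ℝ)) := invMeans.extremePoints ℝ

lemma nonpos_of_ergMeans {φ : ℤ →ᵇ ℝ} (h : ∀ L ∈ ergMeans, L φ ≤ 0) {L : WeakDual ℝ (ℤ →ᵇ ℝ)}
    (hL : L ∈ invMeans) : L φ ≤ 0 := by
  have : LocallyConvexSpace ℝ (WeakDual ℝ (ℤ →ᵇ ℝ)) :=
    LocallyConvexSpace.induced (F := (ℤ →ᵇ ℝ) → ℝ)
      { toFun := fun (L : WeakDual ℝ (ℤ →ᵇ ℝ)) f => L f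
        map_add' := fun _ _ => rfl
        map_smul' := fun _ _ => rfl }
  rw [← closure_convexHull_extremePoints isCompact_invMeans convex_invMeans] at hL
  have hcl : IsClosed {L : WeakDual ℝ (ℤ →ᵇ ℝ) | L φ ≤ 0} :=
    isClosed_le (WeakDual.eval_continuous φ) continuous_const
  have hcv : Convex ℝ {L : WeakDual ℝ (ℤ →ᵇ ℝ) | L φ ≤ 0} := by
    intro L hL L' hL' a b ha hb _
    have h1 : L φ ≤ 0 := hL
    have h2 : L' φ ≤ 0 := hL'
    change a * L φ + b * L' φ ≤ 0
    nlinarith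
  exact closure_minimal (convexHull_min h hcv) hcl hL

/-- The measure of a set under a functional. -/
noncomputable def ms (L : WeakDual ℝ (ℤ →ᵇ ℝ)) (S : Set ℤ) : ℝ := L (ind S)

variable {L : WeakDual ℝ (ℤ →ᵇ ℝ)}

lemma map_mono_of_mem (hL : L ∈ invMeans) {f g : ℤ →ᵇ ℝ} (h : ∀ x, f x ≤ g x) : L f ≤ L g := by
  have := hL.1 (g - f) (fun x => by simpa using h x)
  rw [map_sub] at this
  linarith

lemma ms_nonneg (hL : L ∈ invMeans) (S : Set ℤ) : 0 ≤ ms L S := hL.1 _ (ind_nonneg S)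

lemma ms_mono (hL : L ∈ invMeans) {S T : Set ℤ} (h : S ⊆ T) : ms L S ≤ ms L T :=
  map_mono_of_mem hL fun x => by
    by_cases hx : x ∈ S
    · rw [ind_of_mem hx, ind_of_mem (h hx)]
    · rw [ind_of_notMem hx]; exact ind_nonneg T x

lemma ms_univ (hL : L ∈ invMeans) : ms L Set.univ = 1 := by rw [ms, ind_univ, hL.2.1]

lemma ms_le_one (hL : L ∈ invMeans) (S : Set ℤ) : ms L S ≤ 1 :=
  ms_univ hL ▸ ms_mono hL (Set.subset_univ S)

lemma ms_empty (L : WeakDual ℝ (ℤ →ᵇ ℝ)) : ms L ∅ = 0 := by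
  have : ind ∅ = 0 := by ext x; simp [ind_of_notMem]
  rw [ms, this, map_zero]

lemma ms_tr (hL : L ∈ invMeans) (n : ℤ) (S : Set ℤ) : ms L (tr n S) = ms L S := by
  rw [ms, ind_tr, hL.2.2, ms]

lemma ms_inter_add_diff (L : WeakDual ℝ (ℤ →ᵇ ℝ)) (S T : Set ℤ) :
    ms L (S ∩ T) + ms L (S \ T) = ms L S := by
  rw [ms, ms, ms, ← map_add]
  congr 1
  ext x
  by_cases h : x ∈ S <;> by_cases h' : x ∈ T <;> simp [ind_of_mem, ind_of_notMem, h, h']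

lemma ms_union_add_inter (L : WeakDual ℝ (ℤ →ᵇ ℝ)) (S T : Set ℤ) :
    ms L (S ∪ T) + ms L (S ∩ T) = ms L S + ms L T := by
  rw [ms, ms, ms, ms, ← map_add, ← map_add]
  congr 1
  ext x
  by_cases h : x ∈ S <;> by_cases h' : x ∈ T <;> simp [ind_of_mem, ind_of_notMem, h, h']

lemma ms_union_le (hL : L ∈ invMeans) (S T : Set ℤ) : ms L (S ∪ T) ≤ ms L S + ms L T := by
  linarith [ms_union_add_inter L S T, ms_nonneg hL (S ∩ T)]

lemma ms_biUnion_le (hL : L ∈ invMeans) {ι : Type*} (s : Finset ι) (F : ι → Set ℤ) :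
    ms L (⋃ i ∈ s, F i) ≤ ∑ i ∈ s, ms L (F i) := by
  classical
  induction s using Finset.induction_on with
  | empty => simp [ms_empty]
  | insert a s ha ih =>
    rw [Finset.set_biUnion_insert, Finset.sum_insert ha]
    exact (ms_union_le hL _ _).trans (by linarith)

lemma ms_biUnion (L : WeakDual ℝ (ℤ →ᵇ ℝ)) {ι : Type*} (s : Finset ι) (F : ι → Set ℤ)
    (h : ∀ i ∈ s, ∀ j ∈ s, i ≠ j → Disjoint (F i) (F j)) :
    ms L (⋃ i ∈ s, F i) = ∑ i ∈ s, ms L (F i) := by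
  classical
  induction s using Finset.induction_on with
  | empty => simp [ms_empty]
  | insert a s ha ih =>
    rw [Finset.set_biUnion_insert, Finset.sum_insert ha,
      ← ih (fun i hi j hj => h i (Finset.mem_insert_of_mem hi) j (Finset.mem_insert_of_mem hj)),
      ← ms_union_add_inter]
    have : F a ∩ ⋃ i ∈ s, F i = ∅ := by
      rw [← Set.disjoint_iff_inter_eq_empty, Set.disjoint_iUnion₂_right]
      intro i hi
      exact h a (Finset.mem_insert_self _ _) i (Finset.mem_insert_of_mem hi)
        (fun hai => ha (hai ▸ hi))
    rw [this, ms_empty, add_zero]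

lemma norm_map_ind_mul_shift_le (hL : L ∈ invMeans) (S : Set ℤ) (f : ℤ →ᵇ ℝ) (n : ℤ) :
    ‖L (ind S * shift (-n) f)‖ ≤ ‖f‖ := by
  have h1 := abs_le_of_nonneg hL.1 (ind S * shift (-n) f)
  rw [hL.2.1, mul_one] at h1
  refine h1.trans ((BoundedContinuousFunction.norm_le (norm_nonneg f)).2 fun x => ?_)
  rw [BoundedContinuousFunction.mul_apply, norm_mul]
  by_cases hx : x ∈ S
  · rw [ind_of_mem hx]
    simpa using f.norm_coe_le_norm _
  · rw [ind_of_notMem hx]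
    simp

/-- The correlation function `n ↦ L (ind S * (f translated by n))`. -/
noncomputable def corr (hL : L ∈ invMeans) (S : Set ℤ) (f : ℤ →ᵇ ℝ) : ℤ →ᵇ ℝ :=
  BoundedContinuousFunction.ofNormedAddCommGroupDiscrete
    (fun n => L (ind S * shift (-n) f)) (‖f‖) (fun n => norm_map_ind_mul_shift_le hL S f n)

lemma corr_apply (hL : L ∈ invMeans) (S : Set ℤ) (f : ℤ →ᵇ ℝ) (n : ℤ) :
    corr hL S f n = L (ind S * shift (-n) f) := rfl

lemma corr_ind (hL : L ∈ invMeans) (S T : Set ℤ) (n : ℤ) :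
    corr hL S (ind T) n = ms L (S ∩ tr n T) := by
  rw [corr_apply, ← ind_tr, ind_mul_ind, ms]

lemma norm_corr_le (hL : L ∈ invMeans) (S : Set ℤ) (f : ℤ →ᵇ ℝ) : ‖corr hL S f‖ ≤ ‖f‖ :=
  (BoundedContinuousFunction.norm_le (norm_nonneg f)).2 (norm_map_ind_mul_shift_le hL S f)

/-- The invariant functional `f ↦ L_n (L (ind S * shift (-n) f))`. -/
noncomputable def avgCorr (hL : L ∈ invMeans) (S : Set ℤ) : WeakDual ℝ (ℤ →ᵇ ℝ) :=
  StrongDual.toWeakDual (LinearMap.mkContinuous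
    { toFun := fun f => L (corr hL S f)
      map_add' := fun f g => by
        rw [← map_add]
        congr 1
        ext n
        rw [BoundedContinuousFunction.add_apply, corr_apply, corr_apply, corr_apply, ← map_add]
        congr 1
        ext x
        simp [mul_add]
      map_smul' := fun c f => by
        rw [RingHom.id_apply, ← map_smul]
        congr 1
        ext n
        rw [BoundedContinuousFunction.smul_apply, corr_apply, corr_apply, ← map_smul]
        congr 1
        ext x
        simp [mul_left_comm] } 1 (fun f => by
      have h1 := abs_le_of_nonneg hL.1 (corr hL S f)
      rw [hL.2.1, mul_one] at h1
      rw [one_mul]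
      exact h1.trans (norm_corr_le hL S f)))

lemma avgCorr_apply (hL : L ∈ invMeans) (S : Set ℤ) (f : ℤ →ᵇ ℝ) :
    avgCorr hL S f = L (corr hL S f) := rfl

lemma avgCorr_nonneg (hL : L ∈ invMeans) (S : Set ℤ) {f : ℤ →ᵇ ℝ} (hf : 0 ≤ f) :
    0 ≤ avgCorr hL S f :=
  hL.1 _ fun _ => hL.1 _ fun _ => mul_nonneg (ind_nonneg S _) (hf _)

lemma avgCorr_le (hL : L ∈ invMeans) (S : Set ℤ) {f : ℤ →ᵇ ℝ} (hf : 0 ≤ f) :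
    avgCorr hL S f ≤ L f := by
  have h : ∀ n, corr hL S f n ≤ (L f • (1 : ℤ →ᵇ ℝ)) n := fun n => by
    rw [corr_apply, BoundedContinuousFunction.smul_apply, BoundedContinuousFunction.coe_one,
      Pi.one_apply, smul_eq_mul, mul_one, ← hL.2.2 (-n) f]
    refine map_mono_of_mem hL fun x => ?_
    have h0 : 0 ≤ f (x + -n) := hf _
    by_cases hx : x ∈ S
    · simp [ind_of_mem hx]
    · simpa [ind_of_notMem hx] using h0
  have := map_mono_of_mem hL h
  rwa [map_smul, hL.2.1, smul_eq_mul, mul_one] at this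

lemma avgCorr_shift (hL : L ∈ invMeans) (S : Set ℤ) (n : ℤ) (f : ℤ →ᵇ ℝ) :
    avgCorr hL S (shift n f) = avgCorr hL S f := by
  rw [avgCorr_apply, avgCorr_apply, ← hL.2.2 (-n) (corr hL S f)]
  congr 1
  ext t
  rw [shift_apply, corr_apply, corr_apply]
  congr 2
  ext x
  simp only [shift_apply]
  congr 1
  ring

lemma avgCorr_one (hL : L ∈ invMeans) (S : Set ℤ) : avgCorr hL S 1 = ms L S := by
  have : corr hL S 1 = ms L S • 1 := by
    ext n
    rw [corr_apply, BoundedContinuousFunction.smul_apply, BoundedContinuousFunction.coe_one,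
      Pi.one_apply, smul_eq_mul, mul_one, ms]
    congr 1
    ext x
    simp
  rw [avgCorr_apply, this, map_smul, hL.2.1, smul_eq_mul, mul_one]

lemma inv_smul_mem_invMeans {R : WeakDual ℝ (ℤ →ᵇ ℝ)} (h0 : ∀ f, 0 ≤ f → 0 ≤ R f)
    (hs : ∀ n f, R (shift n f) = R f) (hp : 0 < R 1) : (R 1)⁻¹ • R ∈ invMeans := by
  have happ : ∀ f, ((R 1)⁻¹ • R) f = (R 1)⁻¹ * R f := fun f => rfl
  refine ⟨fun f hf => ?_, ?_, fun n f => ?_⟩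
  · rw [happ]
    exact mul_nonneg (inv_nonneg.2 hp.le) (h0 f hf)
  · rw [happ, inv_mul_cancel₀ hp.ne']
  · rw [happ, happ, hs]

/-- Ergodicity of extreme invariant means. -/
theorem avgCorr_eq_mul (hL : L ∈ ergMeans) (S : Set ℤ) (f : ℤ →ᵇ ℝ) :
    avgCorr hL.1 S f = ms L S * L f := by
  have hM := hL.1
  have key : ∀ R R' : WeakDual ℝ (ℤ →ᵇ ℝ), (∀ f, 0 ≤ f → 0 ≤ R f) → (∀ f, 0 ≤ f → 0 ≤ R' f) →
      (∀ n f, R (shift n f) = R f) → (∀ n f, R' (shift n f) = R' f) → R + R' = L →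
      R f = R 1 * L f := by
    intro R R' h0 h0' hs hs' hsum
    have hadd : ∀ f, R f + R' f = L f := fun f => by rw [← hsum]; rfl
    have h1 : R 1 + R' 1 = 1 := by rw [hadd, hM.2.1]
    have n0 : 0 ≤ R 1 := h0 1 (fun _ => zero_le_one)
    have n0' : 0 ≤ R' 1 := h0' 1 (fun _ => zero_le_one)
    rcases n0.eq_or_lt with hz | hp
    · have := abs_le_of_nonneg h0 f
      rw [← hz, mul_zero] at this
      rw [← hz, zero_mul, abs_nonpos_iff.1 this]
    rcases n0'.eq_or_lt with hz' | hp'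
    · have := abs_le_of_nonneg h0' f
      rw [← hz', mul_zero] at this
      have h2 := abs_nonpos_iff.1 this
      have h3 : R 1 = 1 := by linarith
      rw [h3, one_mul, ← hadd, h2, add_zero]
    · have := hL.2 (inv_smul_mem_invMeans h0 hs hp) (inv_smul_mem_invMeans h0' hs' hp') ⟨R 1, R' 1, hp, hp', h1, by
        rw [smul_smul, smul_smul, mul_inv_cancel₀ hp.ne', mul_inv_cancel₀ hp'.ne', one_smul,
          one_smul, hsum]⟩
      have h4 : (R 1)⁻¹ * R f = L f := by rw [← this]; rfl
      rw [← h4, mul_inv_cancel_left₀ hp.ne']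
  rw [← avgCorr_one hM]
  have hsub : ∀ f, (L - avgCorr hM S) f = L f - avgCorr hM S f := fun f => rfl
  refine key (avgCorr hM S) (L - avgCorr hM S) (fun f hf => avgCorr_nonneg hM S hf)
    (fun f hf => ?_) (avgCorr_shift hM S) (fun n f => ?_) (by abel)
  · rw [hsub]; linarith [avgCorr_le hM S hf]
  · rw [hsub, hsub, hM.2.2, avgCorr_shift]

lemma map_corr_ind (hL : L ∈ ergMeans) (S T : Set ℤ) :
    L (corr hL.1 S (ind T)) = ms L S * ms L T := avgCorr_eq_mul hL S (ind T)

end Means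

section Stability

open BoundedContinuousFunction

variable {L : WeakDual ℝ (ℤ →ᵇ ℝ)}

lemma tr_tr (s t : ℤ) (S : Set ℤ) : tr s (tr t S) = tr (s + t) S := by
  ext x
  simp [sub_sub]

lemma ms_diff_triangle (hL : L ∈ invMeans) (S T U : Set ℤ) :
    ms L (S \ U) ≤ ms L (S \ T) + ms L (T \ U) := by
  refine (ms_mono hL ?_).trans (ms_union_le hL _ _)
  rintro x ⟨hS, hU⟩
  by_cases h : x ∈ T
  · exact Or.inr ⟨h, hU⟩
  · exact Or.inl ⟨hS, h⟩

lemma ms_tr_neg_diff (hL : L ∈ invMeans) (t : ℤ) (A : Set ℤ) :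
    ms L (tr (-t) A \ A) = ms L (tr t A \ A) := by
  have h : tr t (tr (-t) A \ A) = A \ tr t A := by
    ext x
    simp
  have h1 := ms_inter_add_diff L A (tr t A)
  have h2 := ms_inter_add_diff L (tr t A) A
  rw [ms_tr hL, Set.inter_comm] at h2
  rw [← ms_tr hL t, h]
  linarith

lemma ms_tr_add_diff_le (hL : L ∈ invMeans) (s t : ℤ) (A : Set ℤ) :
    ms L (tr (s + t) A \ A) ≤ ms L (tr s A \ A) + ms L (tr t A \ A) := by
  have h : tr s (tr t A \ A) = tr (s + t) A \ tr s A := by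
    rw [← tr_tr]
    rfl
  have := ms_diff_triangle hL (tr (s + t) A) (tr s A) A
  rw [← h, ms_tr hL] at this
  linarith

lemma ms_tr_mul_diff_le (hL : L ∈ invMeans) (n : ℕ) (t : ℤ) (A : Set ℤ) :
    ms L (tr (n * t) A \ A) ≤ n * ms L (tr t A \ A) := by
  induction n with
  | zero =>
    have : tr ((0 : ℕ) * t) A \ A = ∅ := by
      ext x
      simp
    rw [this, ms_empty]
    simp
  | succ n ih =>
    have : ((n + 1 : ℕ) : ℤ) * t = n * t + t := by push_cast; ring
    rw [this]
    have := ms_tr_add_diff_le hL (n * t) t A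
    push_cast
    linarith

/-- The residue class of `r` modulo `G`. -/
def cls {G : ℕ} (r : ZMod G) : Set ℤ := {x | (x : ZMod G) = r}

@[simp] lemma mem_cls {G : ℕ} {r : ZMod G} {x : ℤ} : x ∈ cls r ↔ (x : ZMod G) = r := Iff.rfl

lemma tr_cls {G : ℕ} (n : ℤ) (r : ZMod G) : tr n (cls r) = cls (r + (n : ZMod G)) := by
  ext x
  simp [sub_eq_iff_eq_add]

lemma ms_eq_sum_inter_cls (L : WeakDual ℝ (ℤ →ᵇ ℝ)) {G : ℕ} [NeZero G] (S : Set ℤ) :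
    ms L S = ∑ r : ZMod G, ms L (S ∩ cls r) := by
  rw [← ms_biUnion]
  · congr 1
    ext x
    simp
  · intro i _ j _ hij
    refine Set.disjoint_left.2 fun x hx hx' => hij ?_
    exact (mem_cls.1 hx.2).symm.trans (mem_cls.1 hx'.2)

lemma ms_cls (hL : L ∈ invMeans) {G : ℕ} [NeZero G] (r : ZMod G) : ms L (cls r) = 1 / G := by
  have h : ∀ s : ZMod G, ms L (cls s) = ms L (cls r) := fun s => by
    obtain ⟨n, hn⟩ := ZMod.intCast_surjective (s - r)
    rw [← ms_tr hL n (cls r), tr_cls, hn, add_sub_cancel]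
  have h1 := ms_eq_sum_inter_cls L (G := G) Set.univ
  simp only [Set.univ_inter, ms_univ hL, h, Finset.sum_const, Finset.card_univ, ZMod.card,
    nsmul_eq_mul] at h1
  have hG : (G : ℝ) ≠ 0 := Nat.cast_ne_zero.2 (NeZero.ne G)
  rw [eq_div_iff hG, mul_comm, ← h1]

lemma ms_preimage_cast (hL : L ∈ invMeans) {G : ℕ} [NeZero G] (T : Finset (ZMod G)) :
    ms L {x | (x : ZMod G) ∈ T} = T.card / G := by
  have : {x : ℤ | (x : ZMod G) ∈ T} = ⋃ r ∈ T, cls r := by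
    ext x
    simp
  rw [this, ms_biUnion]
  · simp [ms_cls hL, div_eq_mul_inv]
  · intro i _ j _ hij
    refine Set.disjoint_left.2 fun x hx hx' => hij ?_
    exact (mem_cls.1 hx).symm.trans (mem_cls.1 hx')

lemma exists_mul_ms_tr_diff_le (hL : L ∈ invMeans) (A Q : Set ℤ) {η : ℝ} {N : ℕ}
    (hQ : ∀ t ∈ Q, ms L (tr t A \ A) ≤ η) (hN : 1 < (N + 1) * ms L Q) (u : ℤ) :
    ms L (tr (N.factorial * u) A \ A) ≤ N.factorial * (2 * η) := by
  obtain ⟨i, j, hij, hj, x, hxi, hxj⟩ : ∃ i j : ℕ, i < j ∧ j ≤ N ∧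
      ∃ x, x ∈ tr (i * u) Q ∧ x ∈ tr (j * u) Q := by
    by_contra! hcon
    have := ms_biUnion L (Finset.range (N + 1)) (fun i : ℕ => tr (i * u) Q) (fun i hi j hj hij => by
      rw [Finset.mem_range] at hi hj
      refine Set.disjoint_left.2 fun x hx hx' => ?_
      rcases lt_or_gt_of_ne hij with h | h
      · exact hcon i j h (by omega) x hx hx'
      · exact hcon j i h (by omega) x hx' hx)
    simp only [ms_tr hL, Finset.sum_const, Finset.card_range, nsmul_eq_mul] at this
    push_cast at this
    linarith [ms_le_one hL (⋃ i ∈ Finset.range (N + 1), tr (i * u) Q)]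
  have h1 := hQ _ hxi
  have h2 := hQ _ hxj
  rw [← ms_tr_neg_diff hL] at h2
  have h3 := ms_tr_add_diff_le hL (x - i * u) (-(x - j * u)) A
  have h4 : (x - i * u) + -(x - j * u) = ((j - i : ℕ) : ℤ) * u := by
    rw [Nat.cast_sub hij.le]
    ring
  rw [h4] at h3
  obtain ⟨c, hc⟩ := Nat.dvd_factorial (by omega : 0 < j - i) (by omega : j - i ≤ N)
  have h5 := ms_tr_mul_diff_le hL c (((j - i : ℕ) : ℤ) * u) A
  have h6 : (c : ℤ) * (((j - i : ℕ) : ℤ) * u) = N.factorial * u := by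
    rw [hc]
    push_cast
    ring
  rw [h6] at h5
  have h7 : (c : ℝ) ≤ N.factorial := by
    rw [hc]
    exact_mod_cast Nat.le_mul_of_pos_left c (by omega)
  have h8 : 0 ≤ 2 * η := by linarith [ms_nonneg hL (tr (((j - i : ℕ) : ℤ) * u) A \ A)]
  calc _ ≤ _ := h5
    _ ≤ c * (2 * η) := by gcongr; linarith
    _ ≤ _ := by gcongr

lemma ms_cls_diff_le (hL : L ∈ ergMeans) {A : Set ℤ} {G : ℕ} [NeZero G] {κ γ : ℝ} (hγ : 0 < γ)
    (hG : ∀ u : ℤ, ms L (tr (G * u) A \ A) ≤ κ) (r : ZMod G) (hA : γ / G ≤ ms L (A ∩ cls r)) :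
    ms L (cls r \ A) ≤ κ / γ := by
  have hM := hL.1
  have hG0 : (0 : ℝ) < G := Nat.cast_pos.2 (NeZero.pos G)
  set m := ms L (A ∩ cls r) with hm
  have h1 := map_corr_ind hL (A ∩ cls r) (A ∩ cls r)
  have h2 : L ((m - κ) • ind (cls (0 : ZMod G))) ≤ L (corr hM (A ∩ cls r) (ind (A ∩ cls r))) := by
    refine map_mono_of_mem hM fun n => ?_
    rw [corr_ind, BoundedContinuousFunction.smul_apply, smul_eq_mul]
    by_cases hn : n ∈ cls (0 : ZMod G)
    · rw [ind_of_mem hn, mul_one]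
      obtain ⟨u, rfl⟩ := (ZMod.intCast_zmod_eq_zero_iff_dvd n G).1 hn
      have h3 := ms_inter_add_diff L (tr (G * u) (A ∩ cls r)) (A ∩ cls r)
      rw [ms_tr hM, Set.inter_comm, ← hm] at h3
      have h4 : ms L (tr (G * u) (A ∩ cls r) \ (A ∩ cls r)) ≤ ms L (tr (G * u) A \ A) := by
        refine ms_mono hM ?_
        rintro x ⟨⟨hxA, hxr⟩, hx⟩
        refine ⟨hxA, fun hxA' => hx ⟨hxA', ?_⟩⟩
        simpa using hxr
      linarith [hG u]
    · rw [ind_of_notMem hn, mul_zero]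
      exact ms_nonneg hM _
  rw [h1, map_smul, smul_eq_mul] at h2
  change (m - κ) * ms L _ ≤ m * m at h2
  rw [ms_cls hM] at h2
  have h5 := ms_inter_add_diff L (cls r) A
  rw [ms_cls hM, Set.inter_comm, ← hm] at h5
  set d := ms L (cls r \ A)
  have hd : 0 ≤ d := ms_nonneg hM _
  rw [le_div_iff₀ hγ]
  have h6 : (m - κ) * (1 / G) * G ≤ m * m * G := by gcongr
  have h7 : (m - κ) * (1 / G) * G = m - κ := by field_simp
  have h8 : m * G + d * G = 1 := by rw [← add_mul, h5]; field_simp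
  have h9 : d * γ ≤ d * (m * G) := mul_le_mul_of_nonneg_left (by rwa [div_le_iff₀ hG0] at hA) hd
  have h10 : m * (m * G + d * G) = m := by rw [h8, mul_one]
  linarith

/-- If `A` almost contains all translates of `B` by its elements, then `A` almost contains a
subgroup whose index is controlled by the size of `B`. -/
theorem ms_cls_zero_diff_le (hL : L ∈ ergMeans) {A B : Set ℤ} {δ ε : ℝ} {N : ℕ} (hδ : 0 < δ)
    (hε : 0 < ε)
    (hN : 1 < (N + 1) * (δ ^ 2 / 2)) (h0 : (0 : ℤ) ∈ A) (hB : δ ≤ ms L B)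
    (hst : ∀ e ∈ A, ms L (tr e B \ A) ≤ ε) (hε1 : ε ≤ δ ^ 2 / 4)
    (hε2 : ε ≤ δ / (2 * N.factorial)) :
    ms L (cls (0 : ZMod N.factorial) \ A) ≤ 16 * N.factorial / δ ^ 3 * ε := by
  have hM := hL.1
  have : NeZero N.factorial := ⟨N.factorial_ne_zero⟩
  have hG0 : (0 : ℝ) < N.factorial := Nat.cast_pos.2 N.factorial_pos
  set G := N.factorial with hGdef
  set X : Set ℤ := {n | n ∉ A ∧ δ ^ 2 / 4 < ms L (A ∩ tr n B)} with hX
  have hmX : ms L X ≤ 4 * ε / δ ^ 2 := by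
    have h1 : L ((ms L B - ε) • ind A + (δ ^ 2 / 4) • ind X) ≤ L (corr hM A (ind B)) := by
      refine map_mono_of_mem hM fun n => ?_
      simp only [BoundedContinuousFunction.add_apply, BoundedContinuousFunction.smul_apply,
        smul_eq_mul, corr_ind]
      by_cases hn : n ∈ A
      · have hnX : n ∉ X := fun h => h.1 hn
        rw [ind_of_mem hn, ind_of_notMem hnX]
        have := ms_inter_add_diff L (tr n B) A
        rw [ms_tr hM, Set.inter_comm] at this
        linarith [hst n hn]
      · rw [ind_of_notMem hn]
        by_cases hnX : n ∈ X
        · rw [ind_of_mem hnX]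
          linarith [hnX.2]
        · rw [ind_of_notMem hnX]
          linarith [ms_nonneg hM (A ∩ tr n B)]
    rw [map_corr_ind hL, map_add, map_smul, map_smul] at h1
    change (ms L B - ε) * ms L A + (δ ^ 2 / 4) * ms L X ≤ ms L A * ms L B at h1
    rw [le_div_iff₀ (by positivity)]
    nlinarith [ms_le_one hM A]
  set Q : Set ℤ := {t | δ ^ 2 / 2 < ms L (B ∩ tr t B)} with hQ
  have hB2 : δ ^ 2 ≤ ms L B * ms L B := by nlinarith
  have hmQ : δ ^ 2 / 2 ≤ ms L Q := by
    have h1 : L (corr hM B (ind B)) ≤ L (ind Q + (δ ^ 2 / 2) • (1 : ℤ →ᵇ ℝ)) := by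
      refine map_mono_of_mem hM fun n => ?_
      simp only [BoundedContinuousFunction.add_apply, BoundedContinuousFunction.smul_apply,
        smul_eq_mul, corr_ind, BoundedContinuousFunction.coe_one, Pi.one_apply, mul_one]
      by_cases hn : n ∈ Q
      · rw [ind_of_mem hn]
        linarith [ms_le_one hM (B ∩ tr n B), sq_nonneg δ]
      · rw [ind_of_notMem hn]
        simp only [hQ, Set.mem_ofPred_eq, not_lt] at hn
        linarith
    rw [map_corr_ind hL, map_add, map_smul, hM.2.1] at h1
    change ms L B * ms L B ≤ ms L Q + δ ^ 2 / 2 * 1 at h1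
    linarith
  have hQX : ∀ t ∈ Q, ms L (tr t A \ A) ≤ 4 * ε / δ ^ 2 := by
    intro t ht
    refine (ms_mono hM ?_).trans hmX
    rintro x ⟨hxt, hxA⟩
    refine ⟨hxA, ?_⟩
    have h1 : ms L (tr (x - t) (B ∩ tr t B)) ≤ ms L ((A ∩ tr x B) ∪ (tr (x - t) B \ A)) := by
      refine ms_mono hM ?_
      rintro y ⟨hy1, hy2⟩
      by_cases hyA : y ∈ A
      · refine Or.inl ⟨hyA, ?_⟩
        have h : y - (x - t) - t ∈ B := hy2
        rwa [sub_sub, sub_add_cancel] at h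
      · exact Or.inr ⟨hy1, hyA⟩
    rw [ms_tr hM] at h1
    have h2 := ms_union_le hM (A ∩ tr x B) (tr (x - t) B \ A)
    have h3 := hst _ hxt
    have h4 : δ ^ 2 / 2 < ms L (B ∩ tr t B) := ht
    linarith
  have hper := exists_mul_ms_tr_diff_le hM A Q (N := N) hQX (hN.trans_le (by gcongr))
  obtain ⟨r, -, hr⟩ : ∃ r ∈ Finset.univ, δ / G ≤ ms L (B ∩ cls (r : ZMod G)) := by
    refine Finset.exists_le_of_sum_le (Finset.univ_nonempty (α := ZMod G)) ?_
    rw [← ms_eq_sum_inter_cls, Finset.sum_const, Finset.card_univ, ZMod.card, nsmul_eq_mul,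
      mul_div_cancel₀ _ hG0.ne']
    exact hB
  have hstep : ∀ e ∈ A, δ / 2 / G ≤ ms L (A ∩ cls (r + (e : ZMod G))) := by
    intro e he
    have h1 : ms L (tr e (B ∩ cls r) \ A) ≤ ε :=
      (ms_mono hM (T := tr e B \ A) fun x hx => ⟨hx.1.1, hx.2⟩).trans (hst e he)
    have h2 := ms_inter_add_diff L (tr e (B ∩ cls r)) A
    rw [ms_tr hM] at h2
    have h3 : ms L (tr e (B ∩ cls r) ∩ A) ≤ ms L (A ∩ cls (r + (e : ZMod G))) := by
      refine ms_mono hM ?_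
      rintro x ⟨hx, hxA⟩
      refine ⟨hxA, ?_⟩
      rw [← tr_cls]
      exact hx.2
    have h4 : δ / G = δ / 2 / G + δ / (2 * G) := by field_simp; norm_num
    linarith
  have hchain : ∀ j : ℕ, ∃ e ∈ A, (e : ZMod G) = j * r := by
    intro j
    induction j with
    | zero => exact ⟨0, h0, by simp⟩
    | succ j ih =>
      obtain ⟨e, he, hej⟩ := ih
      have h1 := hstep e he
      have hne : (A ∩ cls (r + (e : ZMod G))).Nonempty := by
        rw [Set.nonempty_iff_ne_empty]
        intro h
        rw [h, ms_empty] at h1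
        have : 0 < δ / 2 / G := by positivity
        linarith
      obtain ⟨x, hxA, hx⟩ := hne
      exact ⟨x, hxA, by rw [mem_cls.1 hx, hej]; push_cast; ring⟩
  obtain ⟨e, he, hej⟩ := hchain (G - 1)
  have h1 := hstep e he
  have h2 : r + (e : ZMod G) = 0 := by
    rw [hej, Nat.cast_sub N.factorial_pos]
    simp
  rw [h2] at h1
  have h3 := ms_cls_diff_le hL (half_pos hδ) hper 0 h1
  refine h3.trans (le_of_eq ?_)
  field_simp
  ring

end Stability

section ErgodicKneser

open BoundedContinuousFunction

variable {L : WeakDual ℝ (ℤ →ᵇ ℝ)}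

theorem exists_ms_cls_zero_diff_eq_zero {δ : ℝ} (hδ : 0 < δ) :
    ∃ G : ℕ, 0 < G ∧ ∀ L ∈ ergMeans, ∀ A B C : Set ℤ, (0 : ℤ) ∈ A → (0 : ℤ) ∈ B → A + B ⊆ C →
      ms L C + δ ≤ ms L A + ms L B → ms L (cls (0 : ZMod G) \ C) = 0 := by
  obtain ⟨N, hN⟩ := exists_nat_gt (1 / (δ ^ 2 / 2))
  have hN' : 1 < (N + 1) * (δ ^ 2 / 2) := by
    rw [div_lt_iff₀ (by positivity)] at hN
    nlinarith [sq_nonneg δ]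
  refine ⟨N.factorial, N.factorial_pos, fun L hL A B C hA hB hC hm => ?_⟩
  have hM := hL.1
  let F : Set ℤ → Set ℤ → Prop := fun A' B' =>
    (0 : ℤ) ∈ A' ∧ (0 : ℤ) ∈ B' ∧ A' + B' ⊆ C ∧ ms L A + ms L B ≤ ms L A' + ms L B'
  let V : Set ℝ := {v | ∃ A' B', F A' B' ∧ ms L B' = v}
  have hVb : BddBelow V := ⟨0, by rintro v ⟨A', B', -, rfl⟩; exact ms_nonneg hM B'⟩
  have hVn : V.Nonempty := ⟨ms L B, A, B, ⟨hA, hB, hC, le_rfl⟩, rfl⟩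
  have hsub : ∀ A' B', F A' B' → A' ⊆ C := fun A' B' h x hx => by
    simpa using h.2.2.1 (Set.add_mem_add hx h.2.1)
  have hsmall : ∀ ε : ℝ, 0 < ε → ε ≤ δ ^ 2 / 4 → ε ≤ δ / (2 * N.factorial) →
      ms L (cls (0 : ZMod N.factorial) \ C) ≤ 16 * N.factorial / δ ^ 3 * ε := by
    intro ε hε h1 h2
    obtain ⟨v, ⟨A', B', hF, rfl⟩, hv⟩ := exists_lt_of_csInf_lt hVn (lt_add_of_pos_right (sInf V) hε)
    have hAC := hsub A' B' hF
    have hB' : δ ≤ ms L B' := by linarith [ms_mono hM hAC, hF.2.2.2]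
    obtain ⟨h0A, h0B, hS, hsum⟩ := hF
    have hst : ∀ e ∈ A', ms L (tr e B' \ A') ≤ ε := by
      intro e he
      have htr : ms L (B' ∩ tr (-e) A') = ms L (A' ∩ tr e B') := by
        rw [← ms_tr hM e]
        congr 1
        ext x
        simp [and_comm]
      have h3 := ms_union_add_inter L A' (tr e B')
      rw [ms_tr hM] at h3
      have hF' : F (A' ∪ tr e B') (B' ∩ tr (-e) A') := by
        refine ⟨Or.inl h0A, ⟨h0B, by simpa using he⟩, ?_, by rw [htr, h3]; exact hsum⟩
        rintro _ ⟨x, hx | hx, y, ⟨hy, hy'⟩, rfl⟩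
        · exact hS (Set.add_mem_add hx hy)
        · rw [mem_tr] at hx hy'
          have := hS (Set.add_mem_add hy' hx)
          rwa [show y - -e + (x - e) = x + y by ring] at this
      have h4 : sInf V ≤ ms L (B' ∩ tr (-e) A') := csInf_le hVb ⟨_, _, hF', rfl⟩
      have h5 := ms_inter_add_diff L (tr e B') A'
      rw [ms_tr hM, Set.inter_comm, ← htr] at h5
      linarith
    refine (ms_mono hM (Set.sdiff_subset_sdiff_right hAC)).trans ?_
    exact ms_cls_zero_diff_le hL hδ hε hN' h0A hB' hst h1 h2
  refine le_antisymm ?_ (ms_nonneg hM _)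
  by_contra! hpos
  have hG : (0 : ℝ) < N.factorial := Nat.cast_pos.2 N.factorial_pos
  set v := ms L (cls (0 : ZMod N.factorial) \ C)
  set K := 16 * (N.factorial : ℝ) / δ ^ 3 with hK
  have hKpos : 0 < K := by positivity
  have := hsmall (min (v / (2 * K)) (min (δ ^ 2 / 4) (δ / (2 * N.factorial))))
    (by positivity) ((min_le_right _ _).trans (min_le_left _ _))
    ((min_le_right _ _).trans (min_le_right _ _))
  have h2 : K * min (v / (2 * K)) (min (δ ^ 2 / 4) (δ / (2 * N.factorial))) ≤ K * (v / (2 * K)) :=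
    mul_le_mul_of_nonneg_left (min_le_left _ _) hKpos.le
  have h3 : K * (v / (2 * K)) = v / 2 := by field_simp
  linarith

/-- The union of the residue classes modulo `G` which meet `S`. -/
def sat (G : ℕ) (S : Set ℤ) : Set ℤ := {x | ∃ c ∈ S, (x : ZMod G) = c}

lemma subset_sat (G : ℕ) (S : Set ℤ) : S ⊆ sat G S := fun x hx => ⟨x, hx, rfl⟩

lemma sat_mono_of_dvd {G G' : ℕ} (h : G ∣ G') (S : Set ℤ) : sat G' S ⊆ sat G S := by
  rintro x ⟨c, hc, hx⟩
  refine ⟨c, hc, ?_⟩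
  rw [ZMod.intCast_eq_intCast_iff_dvd_sub] at hx ⊢
  exact (Int.natCast_dvd_natCast.2 h).trans hx

lemma ms_sat_eq {L L' : WeakDual ℝ (ℤ →ᵇ ℝ)} (hL : L ∈ invMeans) (hL' : L' ∈ invMeans)
    {G : ℕ} (hG : 0 < G) (S : Set ℤ) : ms L (sat G S) = ms L' (sat G S) := by
  classical
  have : NeZero G := ⟨hG.ne'⟩
  have h : sat G S = {x : ℤ | (x : ZMod G) ∈ Finset.univ.filter fun r => ∃ c ∈ S, r = (c : ZMod G)} := by
    ext x
    simp [sat]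
  rw [h, ms_preimage_cast hL, ms_preimage_cast hL']

lemma exists_ms_sat_diff_eq_zero (hL : L ∈ ergMeans) {A : Set ℤ}
    (hpos : 0 < 2 * ms L A - ms L (A + A)) :
    ∃ G : ℕ, 0 < G ∧ ms L (sat G (A + A) \ (A + A)) = 0 := by
  have hM := hL.1
  obtain ⟨G, hG, h⟩ := exists_ms_cls_zero_diff_eq_zero hpos
  have : NeZero G := ⟨hG.ne'⟩
  refine ⟨G, hG, ?_⟩
  rw [ms_eq_sum_inter_cls (G := G)]
  refine Finset.sum_eq_zero fun r _ => le_antisymm ?_ (ms_nonneg hM _)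
  by_cases hr : ∃ c ∈ A + A, (c : ZMod G) = r
  · obtain ⟨_, ⟨a, ha, b, hb, rfl⟩, rfl⟩ := hr
    have h1 := h L hL (tr (-a) A) (tr (-b) A) (tr (-(a + b)) (A + A)) (by simpa using ha)
      (by simpa using hb) (by
        rintro _ ⟨x, hx, y, hy, rfl⟩
        rw [mem_tr] at hx hy ⊢
        have := Set.add_mem_add hx hy
        rwa [show x - -a + (y - -b) = x + y - -(a + b) by ring] at this)
      (by rw [ms_tr hM, ms_tr hM, ms_tr hM]; linarith)
    rw [← h1, ← ms_tr hM (-(a + b))]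
    refine ms_mono hM ?_
    rintro x ⟨⟨-, hx⟩, hxr⟩
    refine ⟨?_, hx⟩
    rw [mem_cls, Int.cast_sub, sub_eq_iff_eq_add] at hxr
    rw [mem_cls, hxr]
    push_cast
    ring
  · have : (sat G (A + A) \ (A + A)) ∩ cls r = ∅ := by
      rw [Set.eq_empty_iff_forall_notMem]
      rintro x ⟨⟨⟨c, hc, hxc⟩, -⟩, hxr⟩
      exact hr ⟨c, hc, hxc.symm.trans hxr⟩
    rw [this, ms_empty]

lemma eq_of_diff_eq_zero {S T : Set ℤ} (hST : S ⊆ T)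
    (h : ms L (T \ S) = 0) : ms L T = ms L S := by
  have := ms_inter_add_diff L T S
  rw [h, Set.inter_eq_right.2 hST] at this
  linarith

/-- A common period for all ergodic means for which the doubling of `A` is small. -/
theorem exists_common_period {A : Set ℤ} {m : WeakDual ℝ (ℤ →ᵇ ℝ)} (hm : m ∈ invMeans)
    (hpos : 0 < 2 * ms m A - ms m (A + A)) :
    ∃ k : ℕ, 0 < k ∧ ∀ L ∈ ergMeans, 0 < 2 * ms L A - ms L (A + A) →
      ms L ((A + A + (AddSubgroup.zmultiples (k : ℤ) : Set ℤ)) \ (A + A)) = 0 ∧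
      2 * ms L A - ms L (A + A) ≤ 1 / k := by
  classical
  obtain ⟨L₀, hL₀, hpos₀⟩ : ∃ L ∈ ergMeans, 0 < 2 * ms L A - ms L (A + A) := by
    by_contra! hcon
    have := nonpos_of_ergMeans (φ := (2 : ℝ) • ind A - ind (A + A)) (fun L hL => by
      rw [map_sub, map_smul]
      exact hcon L hL) hm
    rw [map_sub, map_smul] at this
    exact absurd hpos (not_lt.2 this)
  obtain ⟨G, hG, hG₀⟩ := exists_ms_sat_diff_eq_zero hL₀ hpos₀
  have : NeZero G := ⟨hG.ne'⟩
  set R : Finset (ZMod G) := Finset.univ.filter fun r => ∃ a ∈ A, (a : ZMod G) = r with hR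
  have hRmem : ∀ r, r ∈ R ↔ ∃ a ∈ A, (a : ZMod G) = r := fun r => by simp [hR]
  have hAR : A ⊆ {x : ℤ | (x : ZMod G) ∈ R} := fun x hx => (hRmem _).2 ⟨x, hx, rfl⟩
  have hAne : A.Nonempty := by
    rw [Set.nonempty_iff_ne_empty]
    rintro rfl
    simp [ms_empty] at hpos₀
  have hRne : R.Nonempty := by
    obtain ⟨a, ha⟩ := hAne
    exact ⟨a, hAR ha⟩
  have hsat : sat G (A + A) = {x : ℤ | (x : ZMod G) ∈ R + R} := by
    ext x
    rw [Set.mem_ofPred_eq, Finset.mem_add]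
    constructor
    · rintro ⟨_, ⟨a, ha, b, hb, rfl⟩, hx⟩
      exact ⟨a, hAR ha, b, hAR hb, by rw [hx]; push_cast; rfl⟩
    · rintro ⟨r, hr, s, hs, hx⟩
      obtain ⟨a, ha, rfl⟩ := (hRmem r).1 hr
      obtain ⟨b, hb, rfl⟩ := (hRmem s).1 hs
      exact ⟨a + b, Set.add_mem_add ha hb, by rw [← hx]; push_cast; rfl⟩
  obtain ⟨H, hH, hcard⟩ : ∃ H : AddSubgroup (ZMod G), (∀ x ∈ R + R, ∀ h ∈ H, x + h ∈ R + R) ∧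
      R.card + R.card ≤ (R + R).card + Nat.card H := by
    convert exists_period_card_add_le R R hRne hRne <;> rfl
  obtain ⟨k, hk⟩ : ∃ k : ℕ, ∀ x : ℤ, (x : ZMod G) ∈ H ↔ (k : ℤ) ∣ x := by
    obtain ⟨a, ha⟩ := Int.subgroup_cyclic (H.comap (Int.castAddHom (ZMod G)))
    refine ⟨a.natAbs, fun x => ?_⟩
    rw [Int.natAbs_dvd, ← Int.mem_zmultiples_iff, AddSubgroup.zmultiples_eq_closure, ← ha]
    rfl
  have hk0 : 0 < k := by
    rw [Nat.pos_iff_ne_zero]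
    rintro rfl
    have := (hk G).1 (by simp [H.zero_mem])
    rw [Nat.cast_zero, zero_dvd_iff] at this
    omega
  have : NeZero k := ⟨hk0.ne'⟩
  refine ⟨k, hk0, fun L hL hLpos => ?_⟩
  have hM := hL.1
  have hHk : (Nat.card H : ℝ) / G = 1 / k := by
    rw [← ms_cls hM (0 : ZMod k), show (cls (0 : ZMod k)) =
      {x : ℤ | (x : ZMod G) ∈ (Finset.univ.filter fun r => r ∈ H)} by
        ext x
        simp [ZMod.intCast_zmod_eq_zero_iff_dvd, hk], ms_preimage_cast hM,
      Nat.card_eq_fintype_card, Fintype.card_subtype]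
  obtain ⟨G', hG', hG'0⟩ := exists_ms_sat_diff_eq_zero hL hLpos
  have hmul : 0 < G' * G := Nat.mul_pos hG' hG
  have hLsat : ms L (sat G (A + A)) = ms L (A + A) := by
    refine le_antisymm ?_ (ms_mono hM (subset_sat _ _))
    rw [ms_sat_eq hM hL₀.1 hG, eq_of_diff_eq_zero (subset_sat _ _) hG₀]
    refine (ms_mono hL₀.1 (subset_sat (G' * G) _)).trans ?_
    rw [ms_sat_eq hL₀.1 hM hmul, ← eq_of_diff_eq_zero (subset_sat _ _) hG'0]
    exact ms_mono hM (sat_mono_of_dvd (Nat.dvd_mul_right _ _) _)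
  constructor
  · refine le_antisymm ?_ (ms_nonneg hM _)
    have h1 : A + A + (AddSubgroup.zmultiples (k : ℤ) : Set ℤ) ⊆ sat G (A + A) := by
      rintro _ ⟨c, hc, z, hz, rfl⟩
      rw [hsat, Set.mem_ofPred_eq]
      have hc' : (c : ZMod G) ∈ R + R := by
        have := subset_sat G _ hc
        rwa [hsat] at this
      have hz' : (z : ZMod G) ∈ H := (hk z).2 (Int.mem_zmultiples_iff.1 hz)
      have := hH _ hc' _ hz'
      push_cast
      exact this
    have h2 := ms_inter_add_diff L (sat G (A + A)) (A + A)
    rw [Set.inter_eq_right.2 (subset_sat _ _), hLsat] at h2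
    linarith [ms_mono hM (Set.sdiff_subset_sdiff_left (t := A + A) h1)]
  · rw [← hLsat, hsat, ms_preimage_cast hM, ← hHk]
    have h1 := ms_mono hM hAR
    rw [ms_preimage_cast hM] at h1
    have h2 : (R.card : ℝ) + R.card ≤ (R + R).card + Nat.card H := by exact_mod_cast hcard
    have hG0 : (0 : ℝ) < G := Nat.cast_pos.2 hG
    have h3 : ((R.card : ℝ) + R.card) / G ≤ ((R + R).card + Nat.card H) / G := by gcongr
    rw [add_div, add_div] at h3
    linarith

end ErgodicKneser

section Core

open BoundedContinuousFunction

variable {L : WeakDual ℝ (ℤ →ᵇ ℝ)}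

/-- The points at distance more than `M` from `E`. -/
def core (E : Set ℤ) (M : ℕ) : Set ℤ := {x | ∀ y : ℤ, |y - x| ≤ M → y ∉ E}

lemma core_antitone (E : Set ℤ) : Antitone (core E) := fun M M' h _ hx y hy =>
  hx y (hy.trans (by exact_mod_cast h))

lemma notMem_of_mem_core {E : Set ℤ} {M : ℕ} {x : ℤ} (hx : x ∈ core E M) : x ∉ E :=
  hx x (by simp)

lemma core_add_natAbs_subset (E : Set ℤ) (M : ℕ) (t : ℤ) :
    core E (M + t.natAbs) ⊆ tr t (core E M) := by
  intro x hx y hy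
  refine hx y ?_
  push_cast
  have : y - x = (y - (x - t)) - t := by ring
  rw [this]
  exact (abs_sub _ _).trans (by gcongr)

lemma ms_core_eq_one (hL : L ∈ invMeans) {E : Set ℤ} (hE : ms L E = 0) (M : ℕ) :
    ms L (core E M) = 1 := by
  refine le_antisymm (ms_le_one hL _) ?_
  have h1 : Set.univ ⊆ core E M ∪ ⋃ t ∈ Finset.Icc (-(M : ℤ)) M, tr t E := by
    intro x _
    by_cases hx : x ∈ core E M
    · exact Or.inl hx
    · simp only [core, Set.mem_ofPred_eq, not_forall, not_not] at hx
      obtain ⟨y, hy, hyE⟩ := hx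
      rw [abs_le] at hy
      refine Or.inr (Set.mem_biUnion (x := x - y) ?_ (by simpa using hyE))
      rw [Finset.mem_coe, Finset.mem_Icc]
      constructor <;> linarith
  have h2 := (ms_mono hL h1).trans (ms_union_le hL _ _)
  have h3 := ms_biUnion_le hL (Finset.Icc (-(M : ℤ)) M) (fun t => tr t E)
  simp only [ms_tr hL, hE, Finset.sum_const_zero] at h3
  rw [ms_univ hL] at h2
  linarith

lemma map_le_mul_ms_core {g : ℤ →ᵇ ℝ} {E : Set ℤ} {κ : ℝ} (hκ : 0 ≤ κ)
    (h : ∀ L ∈ ergMeans, 0 < L g → ms L E = 0 ∧ L g ≤ κ)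
    {R : WeakDual ℝ (ℤ →ᵇ ℝ)} (h0 : ∀ f, 0 ≤ f → 0 ≤ R f)
    (hs : ∀ n f, R (shift n f) = R f) (M : ℕ) : R g ≤ κ * ms R (core E M) := by
  have h1 : ∀ L ∈ invMeans, L g ≤ κ * ms L (core E M) := by
    intro L hL
    have := nonpos_of_ergMeans (φ := g - κ • ind (core E M)) (fun L hL => by
      rw [map_sub, map_smul, smul_eq_mul, sub_nonpos]
      change _ ≤ κ * ms L (core E M)
      rcases le_or_gt (L g) 0 with hg | hg
      · exact hg.trans (mul_nonneg hκ (ms_nonneg hL.1 _))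
      · obtain ⟨hE, hle⟩ := h L hL hg
        rwa [ms_core_eq_one hL.1 hE, mul_one]) hL
    rwa [map_sub, map_smul, smul_eq_mul, sub_nonpos] at this
  have n0 : 0 ≤ R 1 := h0 1 (fun _ => zero_le_one)
  rcases n0.eq_or_lt with hz | hp
  · have := abs_le_of_nonneg h0 g
    rw [← hz, mul_zero] at this
    rw [abs_nonpos_iff.1 this]
    exact mul_nonneg hκ (h0 _ (ind_nonneg _))
  · have h2 : (R 1)⁻¹ * R g ≤ κ * ((R 1)⁻¹ * ms R (core E M)) :=
      h1 _ (inv_smul_mem_invMeans h0 hs hp)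
    rw [mul_left_comm] at h2
    exact le_of_mul_le_mul_left h2 (inv_pos.2 hp)

lemma exists_tendsto_ultrafilter (U : Ultrafilter ℕ) (T : ℕ → (ℤ →ᵇ ℝ) →ₗ[ℝ] ℝ)
    (hT : ∀ n f, |T n f| ≤ ‖f‖) :
    ∃ R : WeakDual ℝ (ℤ →ᵇ ℝ), ∀ f, Tendsto (fun n => T n f) U (nhds (R f)) := by
  have hT' : ∀ n f, ‖T n f‖ ≤ 1 * ‖f‖ := fun n f => by
    rw [one_mul]
    exact hT n f
  let F : ℕ → WeakDual ℝ (ℤ →ᵇ ℝ) := fun n =>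
    StrongDual.toWeakDual ((T n).mkContinuous 1 (hT' n))
  have hF : ∀ n, F n ∈ WeakDual.toStrongDual ⁻¹' Metric.closedBall (0 : StrongDual ℝ (ℤ →ᵇ ℝ)) 1 := by
    intro n
    have hn : ‖(T n).mkContinuous 1 (hT' n)‖ ≤ 1 :=
      LinearMap.mkContinuous_norm_le _ zero_le_one _
    rw [Set.mem_preimage]
    exact Metric.mem_closedBall.2 ((dist_zero_right (WeakDual.toStrongDual (F n))).trans_le hn)
  obtain ⟨R, -, hR⟩ := (WeakDual.isCompact_closedBall (0 : StrongDual ℝ (ℤ →ᵇ ℝ)) 1).ultrafilter_le_nhds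
    (U.map F) (le_principal_iff.2 (Filter.mem_map.2 (Filter.univ_mem' hF)))
  exact ⟨R, fun f => ((WeakDual.eval_continuous f).tendsto R).comp hR⟩

/-- The restriction of a mean to the sets `core E M` has a limit as `M → ∞`. -/
lemma exists_tendsto_ms_inter_core (hL : L ∈ invMeans) (E : Set ℤ) :
    ∃ R : WeakDual ℝ (ℤ →ᵇ ℝ), (∀ f, 0 ≤ f → 0 ≤ R f) ∧ (∀ f, 0 ≤ f → R f ≤ L f) ∧
      (∀ n f, R (shift n f) = R f) ∧ (∀ M, R (ind (core E M)) = R 1) ∧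
      ∀ S, Tendsto (fun M => ms L (S ∩ core E M)) atTop (nhds (ms R S)) := by
  obtain ⟨R, hR⟩ := exists_tendsto_ultrafilter (hyperfilter ℕ) (fun M =>
    { toFun := fun f => L (f * ind (core E M))
      map_add' := fun f g => by rw [← map_add, add_mul]
      map_smul' := fun c f => by rw [RingHom.id_apply, ← map_smul, smul_mul_assoc] }) (by
    intro M f
    have := norm_map_ind_mul_shift_le hL (core E M) f 0
    have h0 : shift (-0) f = f := by ext x; simp
    rwa [h0, mul_comm] at this)
  change ∀ f, Tendsto (fun M => L (f * ind (core E M))) _ _ at hR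
  have hpos : ∀ f : ℤ →ᵇ ℝ, 0 ≤ f → ∀ M, 0 ≤ L (f * ind (core E M)) := fun f hf M =>
    hL.1 _ fun x => mul_nonneg (hf x) (ind_nonneg _ x)
  have hanti : ∀ f : ℤ →ᵇ ℝ, 0 ≤ f → Antitone fun M => L (f * ind (core E M)) := by
    intro f hf M M' hM
    refine map_mono_of_mem hL fun x => mul_le_mul_of_nonneg_left ?_ (hf x)
    by_cases hx : x ∈ core E M'
    · rw [ind_of_mem hx, ind_of_mem (core_antitone E hM hx)]
    · rw [ind_of_notMem hx]
      exact ind_nonneg _ x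
  have hlim : ∀ f : ℤ →ᵇ ℝ, 0 ≤ f →
      Tendsto (fun M => L (f * ind (core E M))) atTop (nhds (R f)) := by
    intro f hf
    have h1 := tendsto_atTop_ciInf (hanti f hf) ⟨0, by rintro _ ⟨M, rfl⟩; exact hpos f hf M⟩
    rwa [tendsto_nhds_unique (hR f) (h1.mono_left Nat.hyperfilter_le_atTop)]
  have hle : ∀ f : ℤ →ᵇ ℝ, 0 ≤ f → ∀ M, R f ≤ L (f * ind (core E M)) := fun f hf =>
    (hanti f hf).le_of_tendsto (hlim f hf)
  have hshift_le : ∀ n (f : ℤ →ᵇ ℝ), 0 ≤ f → R (shift n f) ≤ R f := by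
    intro n f hf
    refine ge_of_tendsto' (hlim f hf) fun M => ?_
    refine (hle (shift n f) (fun x => hf (x + n)) (M + n.natAbs)).trans ?_
    rw [← hL.2.2 n (f * _)]
    refine map_mono_of_mem hL fun x => mul_le_mul_of_nonneg_left ?_ (hf (x + n))
    by_cases hx : x ∈ core E (M + n.natAbs)
    · have h2 : x + n ∈ core E M := by
        rw [← Int.natAbs_neg] at hx
        simpa using core_add_natAbs_subset E M (-n) hx
      rw [ind_of_mem hx]
      exact (ind_of_mem h2).ge
    · rw [ind_of_notMem hx]
      exact ind_nonneg _ _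
  have hshift : ∀ n (f : ℤ →ᵇ ℝ), 0 ≤ f → R (shift n f) = R f := by
    intro n f hf
    refine le_antisymm (hshift_le n f hf) ?_
    have := hshift_le (-n) (shift n f) (fun x => hf (x + n))
    have h : shift (-n) (shift n f) = f := by ext x; simp
    rwa [h] at this
  have hind : ∀ S M, ind S * ind (core E M) = ind (S ∩ core E M) := fun S M => ind_mul_ind _ _
  have h1 := hlim 1 (fun _ => zero_le_one)
  simp only [one_mul] at h1
  refine ⟨R, fun f hf => ge_of_tendsto' (hlim f hf) (hpos f hf), fun f hf => ?_, fun n f => ?_,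
    fun M => ?_, fun S => ?_⟩
  · refine (hle f hf 0).trans (map_mono_of_mem hL fun x => ?_)
    have : ind (core E 0) x ≤ 1 := by
      by_cases hx : x ∈ core E 0
      · rw [ind_of_mem hx]
      · rw [ind_of_notMem hx]
        exact zero_le_one
    exact mul_le_of_le_one_right (hf x) this
  · have hf : 0 ≤ f + ‖f‖ • 1 := fun x => by
      have := (neg_abs_le (f x)).trans' (neg_le_neg (f.norm_coe_le_norm x))
      simp
      linarith
    have h2 := hshift n _ hf
    have h3 : shift n (f + ‖f‖ • 1) = shift n f + ‖f‖ • 1 := by ext x; simp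
    rw [h3, map_add, map_add] at h2
    exact add_right_cancel h2
  · refine tendsto_nhds_unique (hlim _ (ind_nonneg _)) (h1.congr' ?_)
    filter_upwards [eventually_ge_atTop M] with M' hM'
    rw [hind, Set.inter_eq_right.2 (core_antitone E hM')]
  · have := hlim _ (ind_nonneg S)
    simp only [hind] at this
    exact this

theorem exists_core_limits (hL : L ∈ invMeans) {A C E : Set ℤ} {κ : ℝ} (hκ : 0 ≤ κ)
    (h : ∀ L ∈ ergMeans, 0 < 2 * ms L A - ms L C → ms L E = 0 ∧ 2 * ms L A - ms L C ≤ κ) :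
    ∃ a c p : ℝ, Tendsto (fun M => ms L (A ∩ core E M)) atTop (nhds a) ∧
      Tendsto (fun M => ms L (C ∩ core E M)) atTop (nhds c) ∧
      Tendsto (fun M => ms L (core E M)) atTop (nhds p) ∧
      2 * ms L A - ms L C ≤ 2 * a - c ∧ 2 * ms L A - ms L C ≤ κ * p := by
  obtain ⟨R, hR0, hRL, hRs, hRc, hRlim⟩ := exists_tendsto_ms_inter_core hL E
  have hp := hRlim Set.univ
  simp only [Set.univ_inter] at hp
  have hR1 : ms R Set.univ = R 1 := by rw [ms, ind_univ]
  have hg : ∀ L : WeakDual ℝ (ℤ →ᵇ ℝ),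
      L ((2 : ℝ) • ind A - ind C) = 2 * ms L A - ms L C := fun L => by
    rw [map_sub, map_smul]
    rfl
  have h' : ∀ L ∈ ergMeans, 0 < L ((2 : ℝ) • ind A - ind C) →
      ms L E = 0 ∧ L ((2 : ℝ) • ind A - ind C) ≤ κ := by
    simpa only [hg] using h
  refine ⟨ms R A, ms R C, ms R Set.univ, hRlim A, hRlim C, hp, ?_, ?_⟩
  · have hsub : ∀ f, (L - R) f = L f - R f := fun f => rfl
    have h1 : ∀ M, (2 * ms L A - ms L C) - (2 * ms R A - ms R C) ≤
        κ * (ms L (core E M) - ms R Set.univ) := by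
      intro M
      have := map_le_mul_ms_core (R := L - R) hκ h' (fun f hf => by
        rw [hsub]
        linarith [hRL f hf]) (fun n f => by rw [hsub, hsub, hL.2.2, hRs]) M
      rw [hsub, hg, hg, ms.eq_1 (L - R), hsub, hRc, ← hR1] at this
      exact this
    have h2 := ge_of_tendsto' ((hp.sub_const (ms R Set.univ)).const_mul κ) h1
    rw [sub_self, mul_zero] at h2
    linarith
  · refine ge_of_tendsto' (hp.const_mul κ) fun M => ?_
    rw [← hg]
    exact map_le_mul_ms_core hκ h' hL.1 hL.2.2 M

end Core

section Folner

open BoundedContinuousFunction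

lemma add_singleton_eq_tr (S : Set ℤ) (t : ℤ) : S + {t} = tr t S := by
  ext x
  simp [Set.add_singleton, sub_eq_add_neg]

lemma ncard_tr (t : ℤ) (S : Set ℤ) : (tr t S).ncard = S.ncard := by
  rw [← add_singleton_eq_tr, Set.add_singleton]
  exact Set.ncard_image_of_injective S (add_left_injective t)

lemma tr_symmDiff (t : ℤ) (S T : Set ℤ) : tr t (symmDiff S T) = symmDiff (tr t S) (tr t T) := rfl

lemma isFolnerSeq_of_one {F : ℕ → Finset ℤ} (hne : ∀ n, (F n).Nonempty)
    (h : Tendsto (fun n => ((symmDiff (F n : Set ℤ) (tr 1 (F n))).ncard : ℝ) / (F n).card)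
      atTop (nhds 0)) : IsFolnerSeq F := by
  refine ⟨hne, fun t => ?_⟩
  simp only [add_singleton_eq_tr]
  have hfin : ∀ n t, (tr t (F n : Set ℤ)).Finite := fun n t => by
    rw [← add_singleton_eq_tr]
    exact (F n).finite_toSet.add (Set.finite_singleton t)
  have hadd : ∀ n s t, ((symmDiff (F n : Set ℤ) (tr (s + t) (F n))).ncard : ℝ) ≤
      (symmDiff (F n : Set ℤ) (tr s (F n))).ncard + (symmDiff (F n : Set ℤ) (tr t (F n))).ncard := by
    intro n s t
    rw [← ncard_tr s (symmDiff (F n : Set ℤ) (tr t (F n))), tr_symmDiff, tr_tr]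
    norm_cast
    refine (Set.ncard_le_ncard (symmDiff_triangle _ (tr s (F n : Set ℤ)) _) ?_).trans
      (Set.ncard_union_le _ _)
    exact ((F n).finite_toSet.symmDiff (hfin n s)).union ((hfin n s).symmDiff (hfin n _))
  have hneg : ∀ n t, (symmDiff (F n : Set ℤ) (tr (-t) (F n))).ncard =
      (symmDiff (F n : Set ℤ) (tr t (F n))).ncard := by
    intro n t
    rw [← ncard_tr t, tr_symmDiff, tr_tr, add_neg_cancel, symmDiff_comm]
    congr 2
    ext x
    simp
  have hnat : ∀ k : ℕ, Tendsto (fun n =>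
      ((symmDiff (F n : Set ℤ) (tr (k : ℤ) (F n))).ncard : ℝ) / (F n).card) atTop (nhds 0) := by
    intro k
    induction k with
    | zero =>
      have : ∀ n, tr 0 (F n : Set ℤ) = F n := fun n => by
        ext x
        simp
      simp [this]
    | succ k ih =>
      have := ih.add h
      rw [add_zero] at this
      refine squeeze_zero (fun n => by positivity) (fun n => ?_) this
      rw [← add_div]
      push_cast
      gcongr
      exact hadd n k 1
  obtain ⟨k, rfl | rfl⟩ := t.eq_nat_or_neg
  · exact hnat k
  · simp only [hneg]
    exact hnat k

lemma ncard_inter_Icc (S : Set ℤ) (n : ℕ) :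
    ((S ∩ Set.Icc 1 (n : ℤ)).ncard : ℝ) = ∑ i ∈ Finset.range n, ind S (i + 1) := by
  induction n with
  | zero => simp
  | succ n ih =>
    rw [Finset.sum_range_succ, ← ih]
    have hfin : (S ∩ Set.Icc 1 (n : ℤ)).Finite := (Set.finite_Icc _ _).inter_of_right S
    by_cases h : (n : ℤ) + 1 ∈ S
    · have : S ∩ Set.Icc 1 ((n + 1 : ℕ) : ℤ) = insert ((n : ℤ) + 1) (S ∩ Set.Icc 1 (n : ℤ)) := by
        ext x
        simp only [Set.mem_inter_iff, Set.mem_Icc, Set.mem_insert_iff]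
        push_cast
        constructor
        · rintro ⟨hx, h1, h2⟩
          by_cases hxn : x = n + 1
          · exact Or.inl hxn
          · exact Or.inr ⟨hx, h1, by omega⟩
        · rintro (rfl | ⟨hx, h1, h2⟩)
          · exact ⟨h, by omega, le_rfl⟩
          · exact ⟨hx, h1, by omega⟩
      rw [this, Set.ncard_insert_of_notMem (fun hx => by have := hx.2.2; omega) hfin,
        ind_of_mem h]
      push_cast
      ring
    · have : S ∩ Set.Icc 1 ((n + 1 : ℕ) : ℤ) = S ∩ Set.Icc 1 (n : ℤ) := by
        ext x
        simp only [Set.mem_inter_iff, Set.mem_Icc]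
        push_cast
        constructor
        · rintro ⟨hx, h1, h2⟩
          have : x ≠ n + 1 := by
            rintro rfl
            exact h hx
          exact ⟨hx, h1, by omega⟩
        · rintro ⟨hx, h1, h2⟩
          exact ⟨hx, h1, by omega⟩
      rw [this, ind_of_notMem h, add_zero]

lemma ncard_inter_Icc_div_le_one (S : Set ℤ) (n : ℕ) :
    ((S ∩ Set.Icc 1 (n : ℤ)).ncard : ℝ) / n ≤ 1 := by
  refine div_le_one_of_le₀ ?_ n.cast_nonneg
  have h1 := Set.ncard_le_ncard (Set.inter_subset_right (s := S)) (Set.finite_Icc 1 (n : ℤ))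
  rw [← Finset.coe_Icc, Set.ncard_coe_finset, Int.card_Icc] at h1
  exact_mod_cast h1.trans (by omega)

lemma exists_invMean_of_ultrafilter {U : Ultrafilter ℕ} (hU : (U : Filter ℕ) ≤ atTop) :
    ∃ m ∈ invMeans, ∀ S : Set ℤ,
      Tendsto (fun n : ℕ => ((S ∩ Set.Icc 1 (n : ℤ)).ncard : ℝ) / n) U (nhds (ms m S)) := by
  obtain ⟨m, hm⟩ := exists_tendsto_ultrafilter U (fun n =>
    { toFun := fun f => (∑ i ∈ Finset.range n, f (i + 1)) / n
      map_add' := fun f g => by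
        simp only [BoundedContinuousFunction.add_apply, Finset.sum_add_distrib, add_div]
      map_smul' := fun c f => by
        simp only [BoundedContinuousFunction.smul_apply, smul_eq_mul, ← Finset.mul_sum,
          mul_div_assoc, RingHom.id_apply] }) (by
    intro n f
    change |(∑ i ∈ Finset.range n, f (i + 1)) / n| ≤ ‖f‖
    rw [abs_div, Nat.abs_cast]
    refine div_le_of_le_mul₀ n.cast_nonneg (norm_nonneg f) ?_
    refine (Finset.abs_sum_le_sum_abs _ _).trans
      ((Finset.sum_le_sum fun i _ => f.norm_coe_le_norm _).trans ?_)
    simp [mul_comm])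
  change ∀ f : ℤ →ᵇ ℝ,
    Tendsto (fun n : ℕ => (∑ i ∈ Finset.range n, f (i + 1)) / n) U (nhds (m f)) at hm
  have hone : ∀ f : ℤ →ᵇ ℝ, m (shift 1 f) = m f := by
    intro f
    have h1 := (hm (shift 1 f)).sub (hm f)
    have h2 : Tendsto (fun n : ℕ => 2 * ‖f‖ / (n : ℝ)) U (nhds 0) :=
      (tendsto_const_div_atTop_nhds_zero_nat _).mono_left hU
    have h3 : Tendsto (fun n : ℕ => (∑ i ∈ Finset.range n, shift 1 f (i + 1)) / n -
        (∑ i ∈ Finset.range n, f (i + 1)) / n) U (nhds 0) := by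
      refine squeeze_zero_norm (fun n => ?_) h2
      have h4 : (∑ i ∈ Finset.range n, shift 1 f (i + 1)) - ∑ i ∈ Finset.range n, f (i + 1) =
          f (n + 1) - f (0 + 1) := by
        rw [← Finset.sum_sub_distrib]
        have := Finset.sum_range_sub (fun i : ℕ => f (i + 1)) n
        push_cast at this
        exact this
      rw [← sub_div, h4, norm_div, Real.norm_natCast]
      gcongr
      refine (norm_sub_le _ _).trans ?_
      linarith [f.norm_coe_le_norm (n + 1), f.norm_coe_le_norm (0 + 1)]
    exact sub_eq_zero.1 (tendsto_nhds_unique h1 h3)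
  refine ⟨m, ⟨fun f hf => ?_, ?_, fun t f => ?_⟩, fun S => ?_⟩
  · exact ge_of_tendsto' (hm f) fun n =>
      div_nonneg (Finset.sum_nonneg fun i _ => hf _) n.cast_nonneg
  · refine tendsto_nhds_unique (hm 1) (tendsto_const_nhds.congr' ?_)
    filter_upwards [hU (eventually_gt_atTop 0)] with n hn
    have : (n : ℝ) ≠ 0 := by positivity
    simp [this]
  · have hs : ∀ s t (f : ℤ →ᵇ ℝ), shift s (shift t f) = shift (t + s) f := fun s t f => by
      ext x
      simp [add_assoc, add_comm s t]
    induction t using Int.induction_on generalizing f with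
    | zero =>
      congr 1
      ext x
      simp
    | succ i ih => rw [← hs, hone, ih]
    | pred i ih => rw [← hone, hs, sub_add_cancel, ih]
  · simp only [ncard_inter_Icc]
    exact hm (ind S)

theorem exists_invMean_upperDens (A C : Set ℤ) :
    ∃ U : Ultrafilter ℕ, (U : Filter ℕ) ≤ atTop ∧ ∃ m ∈ invMeans, (∀ S : Set ℤ,
      Tendsto (fun n : ℕ => ((S ∩ Set.Icc 1 (n : ℤ)).ncard : ℝ) / n) U (nhds (ms m S))) ∧
      ms m A = upperDens A ∧ ms m C ≤ upperDens C := by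
  have hb : ∀ S : Set ℤ, IsBoundedUnder (· ≤ ·) atTop
      fun n : ℕ => ((S ∩ Set.Icc 1 (n : ℤ)).ncard : ℝ) / n := fun S =>
    isBoundedUnder_of ⟨1, ncard_inter_Icc_div_le_one S⟩
  have hb' : ∀ S : Set ℤ, IsBoundedUnder (· ≥ ·) atTop
      fun n : ℕ => ((S ∩ Set.Icc 1 (n : ℤ)).ncard : ℝ) / n := fun S =>
    isBoundedUnder_of ⟨0, fun n => by positivity⟩
  have hcl : MapClusterPt (upperDens A) atTop
      (fun n : ℕ => ((A ∩ Set.Icc 1 (n : ℤ)).ncard : ℝ) / n) := by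
    rw [mapClusterPt_iff_frequently]
    intro s hs
    obtain ⟨ε, hε, hball⟩ := Metric.mem_nhds_iff.1 hs
    have h1 : ∃ᶠ n : ℕ in atTop,
        upperDens A - ε < ((A ∩ Set.Icc 1 (n : ℤ)).ncard : ℝ) / n :=
      frequently_lt_of_lt_limsup (hb' A).isCoboundedUnder_le (sub_lt_self _ hε)
    have h2 : ∀ᶠ n : ℕ in atTop,
        ((A ∩ Set.Icc 1 (n : ℤ)).ncard : ℝ) / n < upperDens A + ε :=
      eventually_lt_of_limsup_lt (lt_add_of_pos_right _ hε) (hb A)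
    refine (h1.and_eventually h2).mono fun n hn => hball ?_
    rw [Metric.mem_ball, Real.dist_eq, abs_lt]
    constructor <;> linarith [hn.1, hn.2]
  obtain ⟨U, hU, hUA⟩ := mapClusterPt_iff_ultrafilter.1 hcl
  obtain ⟨m, hm, hlim⟩ := exists_invMean_of_ultrafilter hU
  refine ⟨U, hU, m, hm, hlim, tendsto_nhds_unique (hlim A) hUA, ?_⟩
  refine le_of_forall_pos_le_add fun ε hε => le_of_tendsto (hlim C) ?_
  have h2 : ∀ᶠ n : ℕ in atTop,
      ((C ∩ Set.Icc 1 (n : ℤ)).ncard : ℝ) / n < upperDens C + ε :=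
    eventually_lt_of_limsup_lt (lt_add_of_pos_right _ hε) (hb C)
  exact (h2.filter_mono hU).mono fun n hn => hn.le

lemma ncard_symmDiff_tr_le (E : Set ℤ) (M N : ℕ) :
    (symmDiff (core E (M + 1) ∩ Set.Icc 1 (N : ℤ)) (tr 1 (core E (M + 1) ∩ Set.Icc 1 (N : ℤ)))).ncard
      ≤ 2 + ((core E M \ core E (M + 2)) ∩ Set.Icc 1 (N : ℤ)).ncard := by
  have hfin : ((core E M \ core E (M + 2)) ∩ Set.Icc 1 (N : ℤ)).Finite :=
    (Set.finite_Icc _ _).inter_of_right _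
  have hsub : symmDiff (core E (M + 1) ∩ Set.Icc 1 (N : ℤ))
      (tr 1 (core E (M + 1) ∩ Set.Icc 1 (N : ℤ))) ⊆
      {1, (N : ℤ) + 1} ∪ ((core E M \ core E (M + 2)) ∩ Set.Icc 1 (N : ℤ)) := by
    rintro x (⟨⟨hx, h1, h2⟩, hx'⟩ | ⟨⟨hx, h1, h2⟩, hx'⟩)
    · by_cases hx1 : x = 1
      · exact Or.inl (Or.inl hx1)
      refine Or.inr ⟨⟨core_antitone E (Nat.le_succ M) hx, fun hx2 => hx' ⟨?_, ?_, ?_⟩⟩, h1, h2⟩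
      · exact core_add_natAbs_subset E (M + 1) 1 hx2
      · omega
      · omega
    · by_cases hxN : x = N + 1
      · exact Or.inl (Or.inr hxN)
      have h3 : x ∈ Set.Icc 1 (N : ℤ) := ⟨by omega, by omega⟩
      refine Or.inr ⟨⟨?_, fun hx2 => hx' ⟨core_antitone E (Nat.le_succ (M + 1)) hx2, h3⟩⟩, h3⟩
      have := core_add_natAbs_subset E M (-1) hx
      simpa using this
  refine (Set.ncard_le_ncard hsub ((Set.toFinite _).union hfin)).trans ((Set.ncard_union_le _ _).trans ?_)
  gcongr
  exact (Set.ncard_insert_le _ _).trans (by simp)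

theorem exists_folner_core {U : Ultrafilter ℕ} (hU : (U : Filter ℕ) ≤ atTop)
    {m : WeakDual ℝ (ℤ →ᵇ ℝ)}
    (hm : ∀ S : Set ℤ,
      Tendsto (fun n : ℕ => ((S ∩ Set.Icc 1 (n : ℤ)).ncard : ℝ) / n) U (nhds (ms m S)))
    {A C E : Set ℤ} {a c p : ℝ} (hp0 : 0 < p)
    (hA : Tendsto (fun M => ms m (A ∩ core E M)) atTop (nhds a))
    (hC : Tendsto (fun M => ms m (C ∩ core E M)) atTop (nhds c))
    (hp : Tendsto (fun M => ms m (core E M)) atTop (nhds p)) :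
    ∃ (Ψ : ℕ → Finset ℤ) (N : ℕ → ℕ), IsFolnerSeq Ψ ∧ (∀ n, 0 < N n) ∧
      (∀ n, Ψ n ⊆ Finset.Icc 1 (N n : ℤ)) ∧ (∀ n, ∀ x ∈ Ψ n, x ∉ E) ∧
      Tendsto (fun n => ((Ψ n).card : ℝ) / N n) atTop (nhds p) ∧
      Tendsto (dens Ψ A) atTop (nhds (a / p)) ∧ Tendsto (dens Ψ C) atTop (nhds (c / p)) := by
  classical
  have hD : Tendsto (fun M => ms m (core E M \ core E (M + 2))) atTop (nhds 0) := by
    have h1 := hp.sub (hp.comp (tendsto_add_atTop_nat 2))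
    rw [sub_self] at h1
    refine h1.congr fun M => ?_
    have := ms_inter_add_diff m (core E M) (core E (M + 2))
    rw [Set.inter_eq_right.2 (core_antitone E (by omega : M ≤ M + 2))] at this
    simp only [Function.comp_apply]
    linarith
  have happ : ∀ (F : ℕ → Set ℤ) (l : ℝ), Tendsto (fun M => ms m (F M)) atTop (nhds l) →
      ∀ ε > 0, ∀ᶠ M in atTop, ∀ᶠ N : ℕ in U,
        |((F M ∩ Set.Icc 1 (N : ℤ)).ncard : ℝ) / N - l| < ε := by
    intro F l hF ε hε
    filter_upwards [Metric.tendsto_nhds.1 hF (ε / 2) (half_pos hε)] with M hM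
    filter_upwards [Metric.tendsto_nhds.1 (hm (F M)) (ε / 2) (half_pos hε)] with N hN
    rw [Real.dist_eq] at hM hN
    calc _ ≤ _ := abs_sub_le _ (ms m (F M)) _
      _ < ε := by linarith
  have hex : ∀ n : ℕ, ∃ M N : ℕ, n + 1 ≤ N ∧
      0 < ((core E (M + 1) ∩ Set.Icc 1 (N : ℤ)).ncard : ℝ) ∧
      |((A ∩ core E (M + 1) ∩ Set.Icc 1 (N : ℤ)).ncard : ℝ) / N - a| < 1 / ((n : ℝ) + 1) ∧
      |((C ∩ core E (M + 1) ∩ Set.Icc 1 (N : ℤ)).ncard : ℝ) / N - c| < 1 / ((n : ℝ) + 1) ∧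
      |((core E (M + 1) ∩ Set.Icc 1 (N : ℤ)).ncard : ℝ) / N - p| < 1 / ((n : ℝ) + 1) ∧
      |((core E M \ core E (M + 2) ∩ Set.Icc 1 (N : ℤ)).ncard : ℝ) / N - 0| <
        1 / ((n : ℝ) + 1) := by
    intro n
    have hε : 0 < 1 / ((n : ℝ) + 1) := by positivity
    obtain ⟨M, h1, h2, h3, h4, h5⟩ := ((happ _ a (hA.comp (tendsto_add_atTop_nat 1)) _ hε).and
      ((happ _ c (hC.comp (tendsto_add_atTop_nat 1)) _ hε).and
      ((happ _ p (hp.comp (tendsto_add_atTop_nat 1)) _ hε).and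
      ((happ _ p (hp.comp (tendsto_add_atTop_nat 1)) p hp0).and
      (happ _ 0 hD _ hε))))).exists
    obtain ⟨N, k1, k2, k3, k4, k5, k6⟩ :=
      (h1.and (h2.and (h3.and (h4.and (h5.and (hU (eventually_ge_atTop (n + 1)))))))).exists
    refine ⟨M, N, k6, ?_, k1, k2, k3, k5⟩
    rw [abs_lt] at k4
    by_contra! hle
    have := div_nonpos_of_nonpos_of_nonneg hle (Nat.cast_nonneg (α := ℝ) N)
    linarith [k4.1]
  choose M N hN hpos h1 h2 h3 h4 using hex
  have hlim : ∀ (f : ℕ → ℝ) (l : ℝ), (∀ n : ℕ, |f n - l| < 1 / ((n : ℝ) + 1)) →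
      Tendsto f atTop (nhds l) := fun f l hf =>
    tendsto_iff_norm_sub_tendsto_zero.2 (squeeze_zero (fun n => norm_nonneg _)
      (fun n => (hf n).le) tendsto_one_div_add_atTop_nhds_zero_nat)
  let Ψ : ℕ → Finset ℤ := fun n =>
    (Finset.Icc 1 (N n : ℤ)).filter fun x => x ∈ core E (M n + 1)
  have hcoe : ∀ n, (Ψ n : Set ℤ) = core E (M n + 1) ∩ Set.Icc 1 (N n : ℤ) := fun n => by
    ext x
    simp [Ψ, and_comm]
  have hcard : ∀ n, ((Ψ n).card : ℝ) = (core E (M n + 1) ∩ Set.Icc 1 (N n : ℤ)).ncard := fun n => by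
    rw [← hcoe, Set.ncard_coe_finset]
  have hN0 : ∀ n, (0 : ℝ) < N n := fun n => Nat.cast_pos.2 (by linarith [hN n])
  have hΨp : Tendsto (fun n => ((Ψ n).card : ℝ) / N n) atTop (nhds p) := by
    simp only [hcard]
    exact hlim _ _ h3
  have hdens : ∀ (S : Set ℤ) (s : ℝ),
      (∀ n : ℕ, |((S ∩ core E (M n + 1) ∩ Set.Icc 1 (N n : ℤ)).ncard : ℝ) / N n - s| <
        1 / ((n : ℝ) + 1)) → Tendsto (dens Ψ S) atTop (nhds (s / p)) := by
    intro S s hs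
    refine ((hlim _ _ hs).div hΨp hp0.ne').congr fun n => ?_
    rw [Pi.div_apply, dens, hcoe, ← Set.inter_assoc, div_div_div_cancel_right₀ (hN0 n).ne']
  refine ⟨Ψ, N, isFolnerSeq_of_one (fun n => ?_) ?_, fun n => Nat.cast_pos.1 (hN0 n),
    fun n => Finset.filter_subset _ _, fun n x hx => notMem_of_mem_core (Finset.mem_filter.1 hx).2,
    hΨp, hdens A a h1, hdens C c h2⟩
  · rw [← Finset.card_pos, ← Nat.cast_pos (α := ℝ), hcard]
    exact hpos n
  · have h5 : Tendsto (fun n : ℕ => 3 * (1 / ((n : ℝ) + 1)) / (((Ψ n).card : ℝ) / N n)) atTop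
        (nhds 0) := by
      have := ((tendsto_one_div_add_atTop_nhds_zero_nat (𝕜 := ℝ)).const_mul 3).div hΨp hp0.ne'
      rwa [mul_zero, zero_div] at this
    refine squeeze_zero (fun n => by positivity) (fun n => ?_) h5
    rw [← div_div_div_cancel_right₀ (hN0 n).ne' _ ((Ψ n).card : ℝ)]
    gcongr
    rw [hcoe]
    have h6 : ((symmDiff (core E (M n + 1) ∩ Set.Icc 1 (N n : ℤ))
        (tr 1 (core E (M n + 1) ∩ Set.Icc 1 (N n : ℤ)))).ncard : ℝ) ≤
        2 + ((core E (M n) \ core E (M n + 2)) ∩ Set.Icc 1 (N n : ℤ)).ncard := by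
      exact_mod_cast ncard_symmDiff_tr_le E (M n) (N n)
    have h7 := (abs_lt.1 (h4 n)).2
    rw [sub_zero] at h7
    have h8 : 2 / (N n : ℝ) ≤ 2 * (1 / ((n : ℝ) + 1)) := by
      rw [← div_eq_mul_one_div]
      gcongr
      exact_mod_cast hN n
    calc _ ≤ _ := div_le_div_of_nonneg_right h6 (hN0 n).le
      _ ≤ _ := by rw [add_div]; linarith

end Folner

theorem upper_density_corollary (A : Set ℤ) (δ : ℝ)
    (hδ : δ = 2 * upperDens A - upperDens (A + A)) (hpos : 0 < δ) :
    ∃ k : ℕ, 0 < k ∧ ∃ Ψ : ℕ → Finset ℤ, ∃ hΨ : IsFolnerSeq Ψ,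
      (∀ n, ∀ x ∈ Ψ n, 0 < x) ∧
      (k : ℝ) * δ ≤
        liminf (fun n => ((Ψ n).card : ℝ) / (((Ψ n).max' (hΨ.1 n) : ℤ) : ℝ)) atTop ∧
      (∃ dA dAA : ℝ, Tendsto (dens Ψ A) atTop (nhds dA) ∧
        Tendsto (dens Ψ (A + A)) atTop (nhds dAA) ∧ δ ≤ 2 * dA - dAA) ∧
      (∃ d : ℝ, Tendsto (dens Ψ (A + A)) atTop (nhds d) ∧
        Tendsto (dens Ψ (A + A + (AddSubgroup.zmultiples (k : ℤ) : Set ℤ)))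
          atTop (nhds d)) := by
  obtain ⟨U, hU, m, hm, hlim, hmA, hmC⟩ := exists_invMean_upperDens A (A + A)
  have hδm : δ ≤ 2 * ms m A - ms m (A + A) := by rw [hδ, hmA]; linarith
  obtain ⟨k, hk, hper⟩ := exists_common_period hm (hpos.trans_le hδm)
  have hk' : (0 : ℝ) < k := Nat.cast_pos.2 hk
  obtain ⟨a, c, p, ha, hc, hp, hac, hpk⟩ :=
    exists_core_limits hm (one_div_pos.2 hk').le hper
  have hkp : k * δ ≤ p := by
    have h1 : k * δ ≤ k * (1 / k * p) := by gcongr; linarith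
    rwa [← mul_assoc, mul_one_div_cancel hk'.ne', one_mul] at h1
  have hp0 : 0 < p := (mul_pos hk' hpos).trans_le hkp
  have hp1 : p ≤ 1 := le_of_tendsto' hp fun M => ms_le_one hm _
  obtain ⟨Ψ, N, hΨ, hN, hsub, hE, hcard, hdA, hdC⟩ := exists_folner_core hU hlim hp0 ha hc hp
  have hΨpos : ∀ n, ∀ x ∈ Ψ n, 0 < x := fun n x hx => by
    linarith [(Finset.mem_Icc.1 (hsub n hx)).1]
  refine ⟨k, hk, Ψ, hΨ, hΨpos, ?_, ⟨a / p, c / p, hdA, hdC, ?_⟩, c / p, hdC, ?_⟩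
  · have hmax : ∀ n, (0 : ℝ) < ((Ψ n).max' (hΨ.1 n) : ℤ) := fun n =>
      Int.cast_pos.2 (hΨpos n _ (Finset.max'_mem _ _))
    refine hkp.trans (hcard.liminf_eq.symm.le.trans (liminf_le_liminf ?_ ?_ ?_))
    · refine Eventually.of_forall fun n => ?_
      have : ((Ψ n).max' (hΨ.1 n) : ℤ) ≤ (N n : ℝ) := by
        exact_mod_cast (Finset.mem_Icc.1 (hsub n (Finset.max'_mem _ (hΨ.1 n)))).2
      exact div_le_div_of_nonneg_left (Nat.cast_nonneg _) (hmax n) this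
    · exact hcard.isBoundedUnder_ge
    · refine IsBoundedUnder.isCoboundedUnder_ge (isBoundedUnder_of ⟨1, fun n => ?_⟩)
      refine div_le_one_of_le₀ ?_ (hmax n).le
      have h1 : Ψ n ⊆ Finset.Icc 1 ((Ψ n).max' (hΨ.1 n)) := fun x hx =>
        Finset.mem_Icc.2 ⟨hΨpos n x hx, Finset.le_max' _ x hx⟩
      have h2 := Finset.card_le_card h1
      rw [Int.card_Icc] at h2
      have h3 := hΨpos n _ (Finset.max'_mem _ (hΨ.1 n))
      have h4 : ((Ψ n).card : ℤ) ≤ (Ψ n).max' (hΨ.1 n) := by omega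
      exact_mod_cast h4
  · have : δ ≤ (2 * a - c) / p := by
      rw [le_div_iff₀ hp0]
      nlinarith
    rwa [sub_div, mul_div_assoc] at this
  · refine hdC.congr fun n => ?_
    rw [dens, dens]
    congr 3
    ext x
    refine and_congr_left fun hx => ⟨fun h => ?_, fun h => ?_⟩
    · exact ⟨x, h, 0, AddSubgroup.zero_mem _, add_zero x⟩
    · by_contra hx'
      exact hE n x hx ⟨h, hx'⟩

end SumsetMeans
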